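/- arXiv:1311.4450 — 2 statements merged into one kernel-verified Lean document; each statement's English description precedes it below -/
import Mathlib

section
/- Let G be an infinite word hyperbolic group with finite symmetric generating set S, let aₙ be the number of elements of G of word length exactly n with respect to S, and let P_{G,S}(t) = Σ_{n≥0} aₙtⁿ. Then the set Ω(P_{G,S}) of opposite series of P_{G,S} is finite. -/
open SimpleGraph Filter

namespace CF

variable {V : Type*}

/-- A walk in a graph is a geodesic if its length realizes the graph distance
between its endpoints. -/
def IsGeodesic (G : SimpleGraph V) {u v : V} (p : G.Walk u v) : Prop :=
  p.length = G.dist u v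

/-- `G` is δ-hyperbolic: every geodesic triangle is δ-thin, i.e. each side lies
in the δ-neighborhood of the union of the other two sides. -/
def IsDeltaHyperbolic (G : SimpleGraph V) (δ : ℝ) : Prop :=
  ∀ ⦃a b c : V⦄ (p : G.Walk a b) (q : G.Walk b c) (r : G.Walk a c),
    IsGeodesic G p → IsGeodesic G q → IsGeodesic G r →
      (∀ z ∈ p.support, ∃ w, (w ∈ q.support ∨ w ∈ r.support) ∧ (G.dist z w : ℝ) ≤ δ) ∧
      (∀ z ∈ q.support, ∃ w, (w ∈ p.support ∨ w ∈ r.support) ∧ (G.dist z w : ℝ) ≤ δ) ∧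
      (∀ z ∈ r.support, ∃ w, (w ∈ p.support ∨ w ∈ q.support) ∧ (G.dist z w : ℝ) ≤ δ)

/-- `G` has uniformly finite valence. -/
def UnifFiniteValence (G : SimpleGraph V) : Prop :=
  ∃ D : ℕ, ∀ v : V, (G.neighborSet v).Finite ∧ (G.neighborSet v).ncard ≤ D

/-- The automorphism group of `G` acts transitively on vertices. -/
def VertexTransitive (G : SimpleGraph V) : Prop :=
  ∀ u v : V, ∃ φ : G ≃g G, φ u = v

/-- A δ-hyperbolike graph: connected, of uniformly finite valence, δ-hyperbolic
(with δ ≥ 0), and vertex-transitive. -/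
def Hyperbolike (G : SimpleGraph V) (δ : ℝ) : Prop :=
  G.Connected ∧ UnifFiniteValence G ∧ 0 ≤ δ ∧ IsDeltaHyperbolic G δ ∧ VertexTransitive G

/-- The ball of radius `n` about `x` (as a vertex set). -/
def ball (G : SimpleGraph V) (x : V) (n : ℕ) : Set V := {y | G.dist x y ≤ n}

/-- A formal power series over ℝ is rational if `q·P = p` for polynomials `p`, `q`
with `q(0) ≠ 0`. -/
def IsRationalPS (P : PowerSeries ℝ) : Prop :=
  ∃ p q : Polynomial ℝ, q.coeff 0 ≠ 0 ∧ (q : PowerSeries ℝ) * P = (p : PowerSeries ℝ)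

/-- Two geodesics starting at the same point `T`-synchronously fellow travel:
`d(γ(ℓ−i), γ′(ℓ′−i)) ≤ T` for all `0 ≤ i ≤ min(ℓ,ℓ′)`. -/
def SyncFellowTravel (G : SimpleGraph V) (T : ℝ) {x y z : V}
    (p : G.Walk x y) (q : G.Walk x z) : Prop :=
  ∀ i : ℕ, i ≤ min p.length q.length →
    (G.dist (p.getVert (p.length - i)) (q.getVert (q.length - i)) : ℝ) ≤ T

/-- `z` is a competitor of `y` (with respect to the base point `x`):
`z ∈ B_{2δ+1}(y)`, `d(x,z) ≤ d(x,y)`, and some geodesic from `x` to `z`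
`(2δ+1)`-synchronously fellow travels every geodesic from `x` to `y`. -/
def Competitor (G : SimpleGraph V) (δ : ℝ) (x y z : V) : Prop :=
  (G.dist y z : ℝ) ≤ 2*δ+1 ∧ G.dist x z ≤ G.dist x y ∧
  ∃ p : G.Walk x z, IsGeodesic G p ∧
    ∀ q : G.Walk x y, IsGeodesic G q → SyncFellowTravel G (2*δ+1) p q

/-- `F` is a tournament at `y` (with base point `x`); only the values of `F` on
the ball `B_{2δ+1}(y)` are constrained. -/
def Tournament (G : SimpleGraph V) (δ : ℝ) (x y : V) (F : V → ℤ) : Prop :=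
  (∀ z : V, (G.dist y z : ℝ) ≤ 2*δ+1 →
    (G.dist x z : ℤ) - (G.dist x y : ℤ) ≤ F z ∧ F z ≤ (G.dist y z : ℤ)) ∧
  (∀ z : V, Competitor G δ x y z → (G.dist x z : ℤ) = (G.dist x y : ℤ) + F z)

/-- Tournaments `(y,F)` and `(y',F')` have the same type: some automorphism `φ`
carries `y` to `y'` with `F = F' ∘ φ` (on the ball `B_{2δ+1}(y)`). -/
def SameTournamentType (G : SimpleGraph V) (δ : ℝ) (y y' : V) (F F' : V → ℤ) : Prop :=
  ∃ φ : G ≃g G, φ y = y' ∧ ∀ z : V, (G.dist y z : ℝ) ≤ 2*δ+1 → F z = F' (φ z)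

/-- The cone of `y` with respect to the base point `x`. -/
def cone (G : SimpleGraph V) (x y : V) : Set V :=
  {z | G.dist x z = G.dist x y + G.dist y z}

/-- There is a quasi-isometry from the vertices of `G` (with the path metric) to ℝ. -/
def QuasiIsometricToReal (G : SimpleGraph V) : Prop :=
  ∃ (f : V → ℝ) (C : ℝ), 1 ≤ C ∧
    (∀ u v : V, (G.dist u v : ℝ)/C - C ≤ |f u - f v| ∧ |f u - f v| ≤ C * G.dist u v + C) ∧
    (∀ r : ℝ, ∃ v : V, |r - f v| ≤ C)

/-- `G` is nonelementary: infinitely many vertices and not quasi-isometric to ℝ. -/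
def Nonelementary (G : SimpleGraph V) : Prop :=
  Infinite V ∧ ¬ QuasiIsometricToReal G

/-- `ω` is an opposite series of the power series with (positive) coefficients `a`:
the polynomials `Xₙ(P)(s) = Σ_{k≤n} (a_{n-k}/aₙ) s^k` accumulate coefficientwise at `ω`
along some strictly increasing sequence of indices. -/
def OppositeSeries (a : ℕ → ℝ) (ω : ℕ → ℝ) : Prop :=
  ∃ φ : ℕ → ℕ, StrictMono φ ∧
    ∀ k : ℕ, Tendsto (fun j => a (φ j - k) / a (φ j)) atTop (nhds (ω k))

end CF

namespace CF

/-- The Cayley graph of a group with respect to a (symmetric) set of generators. -/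
def cayleyGraph {G : Type*} [Group G] (S : Set G) : SimpleGraph G :=
  SimpleGraph.fromRel (fun g h => g⁻¹ * h ∈ S)

section Growth

open Topology PowerSeries

/-- The coefficient sequence of `(1 - l t)⁻⁽ᵈ⁺¹⁾`. -/
noncomputable def binomGrowth (d : ℕ) (l : ℝ) (n : ℕ) : ℝ := ((d + n).choose d : ℝ) * l ^ n

lemma binomGrowth_pos (d : ℕ) {l : ℝ} (hl : 0 < l) (n : ℕ) : 0 < binomGrowth d l n := by
  have : 0 < (d + n).choose d := Nat.choose_pos (by omega)
  unfold binomGrowth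
  positivity

lemma one_le_choose_add (d n : ℕ) : (1 : ℝ) ≤ ((d + n).choose d : ℝ) := by
  exact_mod_cast Nat.choose_pos (by omega)

lemma choose_succ_add (d n : ℕ) :
    ((d + 1 + n).choose (d + 1) : ℝ) = ((d + n).choose d : ℝ) * ((n + d + 1) / (d + 1)) := by
  have h := Nat.add_one_mul_choose_eq (d + n) d
  have h' : ((d + n : ℕ) + 1 : ℝ) * ((d + n).choose d : ℝ)
      = ((d + 1 + n).choose (d + 1) : ℝ) * (d + 1) := by
    rw [show d + 1 + n = d + n + 1 by ring]
    exact_mod_cast h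
  push_cast at h'
  field_simp
  linarith

lemma tendsto_linear_div_linear (q : ℝ) (a b : ℝ) :
    Tendsto (fun n : ℕ => (q * n + a) / ((n : ℝ) + b)) atTop (𝓝 q) := by
  have h1 : Tendsto (fun n : ℕ => (n : ℝ) + b) atTop atTop :=
    tendsto_atTop_add_const_right _ _ tendsto_natCast_atTop_atTop
  have h2 : Tendsto (fun n : ℕ => q + (a - q * b) / ((n : ℝ) + b)) atTop (𝓝 (q + 0)) :=
    tendsto_const_nhds.add (tendsto_const_nhds.div_atTop h1)
  rw [add_zero] at h2
  refine h2.congr' ?_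
  filter_upwards [h1.eventually_gt_atTop 0] with n hn
  field_simp
  ring

lemma tendsto_choose_affine (d q j : ℕ) :
    Tendsto (fun n : ℕ => ((d + (q * n + j)).choose d : ℝ) / ((d + n).choose d : ℝ)) atTop
      (𝓝 ((q : ℝ) ^ d)) := by
  induction d with
  | zero => simp
  | succ d ih =>
    have h := ih.mul (tendsto_linear_div_linear q (j + d + 1) (d + 1))
    rw [← pow_succ] at h
    refine h.congr fun n => ?_
    rw [choose_succ_add, choose_succ_add]
    have h1 := one_le_choose_add d n
    push_cast
    rw [mul_div_mul_comm, div_div_div_cancel_right₀ (by positivity)]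
    congr 2 <;> ring

lemma tendsto_binomGrowth_affine (d : ℕ) {l : ℝ} (hl : 0 < l) (q j : ℕ) :
    Tendsto (fun n : ℕ => binomGrowth d l (q * n + j) / binomGrowth d (l ^ q) n) atTop
      (𝓝 ((q : ℝ) ^ d * l ^ j)) := by
  refine ((tendsto_choose_affine d q j).mul_const (l ^ j)).congr fun n => ?_
  have h1 := one_le_choose_add d n
  unfold binomGrowth
  rw [pow_add, pow_mul]
  field_simp

lemma tendsto_choose_div_choose {d e : ℕ} (h : d < e) :
    Tendsto (fun n : ℕ => ((d + n).choose d : ℝ) / ((e + n).choose e : ℝ)) atTop (𝓝 0) := by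
  induction e, h using Nat.le_induction with
  | base =>
    have h1 : Tendsto (fun n : ℕ => (n : ℝ) + (d + 1)) atTop atTop :=
      tendsto_atTop_add_const_right _ _ tendsto_natCast_atTop_atTop
    refine ((tendsto_const_nhds (x := (d + 1 : ℝ))).div_atTop h1).congr fun n => ?_
    rw [choose_succ_add]
    have h1 := one_le_choose_add d n
    field_simp
    ring
  | succ e he ih =>
    refine squeeze_zero (fun n => by positivity) (fun n => ?_) ih
    have h1 := one_le_choose_add e n
    have h2 := one_le_choose_add d n
    refine div_le_div_of_nonneg_left (by positivity) (by positivity) ?_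
    rw [choose_succ_add]
    refine le_mul_of_one_le_right (by positivity) ?_
    rw [le_div_iff₀ (by positivity)]
    have : (0 : ℝ) ≤ n := by positivity
    linarith

lemma summable_binomGrowth_mul_pow (d : ℕ) {l x : ℝ} (hl : 0 < l) (hx : 0 ≤ x) (h : l * x < 1) :
    Summable fun n => binomGrowth d l n * x ^ n := by
  have := summable_choose_mul_geometric_of_norm_lt_one d (r := l * x)
    (by rw [Real.norm_of_nonneg (by positivity)]; exact h)
  refine this.congr fun n => ?_
  rw [binomGrowth, mul_pow, add_comm n d]
  ring

lemma tendsto_binomGrowth_div_of_lt (d e : ℕ) {l k : ℝ} (hl : 0 < l) (h : l < k) :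
    Tendsto (fun n => binomGrowth d l n / binomGrowth e k n) atTop (𝓝 0) := by
  have hk : 0 < k := hl.trans h
  have h0 := (summable_binomGrowth_mul_pow d hl (x := k⁻¹) (by positivity)
    (by rw [← div_eq_mul_inv, div_lt_one hk]; exact h)).tendsto_atTop_zero
  refine squeeze_zero (fun n => (div_pos (binomGrowth_pos d hl n) (binomGrowth_pos e hk n)).le)
    (fun n => ?_) h0
  rw [inv_pow, ← div_eq_mul_inv]
  have h1 := one_le_choose_add e n
  have h2 := binomGrowth_pos d hl n
  gcongr
  exact le_mul_of_one_le_left (by positivity) h1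

lemma tendsto_binomGrowth_div_of_degree_lt {d e : ℕ} {l : ℝ} (hl : 0 < l) (h : d < e) :
    Tendsto (fun n => binomGrowth d l n / binomGrowth e l n) atTop (𝓝 0) := by
  refine (tendsto_choose_div_choose h).congr fun n => ?_
  unfold binomGrowth
  rw [mul_div_mul_right _ _ (by positivity)]

lemma binomGrowth_trichotomy (d e : ℕ) {l k : ℝ} (hl : 0 < l) (hk : 0 < k) :
    (d = e ∧ l = k) ∨ Tendsto (fun n => binomGrowth d l n / binomGrowth e k n) atTop (𝓝 0) ∨
      Tendsto (fun n => binomGrowth e k n / binomGrowth d l n) atTop (𝓝 0) := by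
  rcases lt_trichotomy l k with h | rfl | h
  · exact .inr (.inl (tendsto_binomGrowth_div_of_lt d e hl h))
  · rcases lt_trichotomy d e with h | h | h
    · exact .inr (.inl (tendsto_binomGrowth_div_of_degree_lt hl h))
    · exact .inl ⟨h, rfl⟩
    · exact .inr (.inr (tendsto_binomGrowth_div_of_degree_lt hl h))
  · exact .inr (.inr (tendsto_binomGrowth_div_of_lt e d hk h))

lemma mk_binomGrowth_mul (d e : ℕ) (l : ℝ) :
    (PowerSeries.mk (binomGrowth d l)) * PowerSeries.mk (binomGrowth e l)
      = PowerSeries.mk (binomGrowth (d + e + 1) l) := by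
  have h : ∀ d, PowerSeries.mk (binomGrowth d l)
      = PowerSeries.rescale l ((PowerSeries.mk 1 : ℝ⟦X⟧) ^ (d + 1)) := by
    intro d
    rw [PowerSeries.mk_one_pow_eq_mk_choose_add]
    ext n
    simp [binomGrowth, PowerSeries.coeff_rescale, mul_comm]
  rw [h, h, h, ← map_mul, ← pow_add]
  congr 2
  ring

/-- Dominated convergence for convolution-type sums. -/
lemma tendsto_sum_range_mul {F : Filter ℕ} (hF : F ≤ atTop) {p w : ℕ → ℝ} {x : ℕ → ℕ → ℝ}
    {B : ℝ} (hp : Summable fun k => |p k|) (hx : ∀ n k, k ≤ n → |x n k| ≤ B)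
    (hw : ∀ k, Tendsto (fun n => x n k) F (𝓝 (w k))) :
    Tendsto (fun n => ∑ k ∈ Finset.range (n + 1), p k * x n k) F (𝓝 (∑' k, p k * w k)) := by
  have hB : 0 ≤ B := (abs_nonneg _).trans (hx 0 0 le_rfl)
  have key : Tendsto (fun n => ∑' k, p k * (if k ≤ n then x n k else 0)) F
      (𝓝 (∑' k, p k * w k)) := by
    refine tendsto_tsum_of_dominated_convergence (bound := fun k => |p k| * B)
      (hp.mul_right B) (fun k => ?_) (Eventually.of_forall fun n k => ?_)
    · refine ((hw k).congr' ?_).const_mul _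
      filter_upwards [hF (eventually_ge_atTop k)] with n hn
      rw [if_pos hn]
    · rw [Real.norm_eq_abs, abs_mul]
      gcongr
      split_ifs with h
      · exact hx n k h
      · simpa using hB
  refine key.congr fun n => ?_
  rw [tsum_eq_sum (s := Finset.range (n + 1))]
  · refine Finset.sum_congr rfl fun k hk => ?_
    rw [if_pos (by simpa [Nat.lt_succ_iff] using hk)]
  · intro k hk
    rw [if_neg (by simpa [Nat.lt_succ_iff] using hk), mul_zero]

lemma coeff_mul_range (f g : ℝ⟦X⟧) (n : ℕ) :
    PowerSeries.coeff n (f * g)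
      = ∑ k ∈ Finset.range (n + 1), PowerSeries.coeff k f * PowerSeries.coeff (n - k) g := by
  rw [PowerSeries.coeff_mul, Finset.Nat.sum_antidiagonal_eq_sum_range_succ_mk]

end Growth

section Regular

open Topology PowerSeries

/-- A nonnegative sequence which is eventually zero or asymptotic to `c nᵈ lⁿ`. -/
def Regular (u : ℕ → ℝ) : Prop :=
  (∀ n, 0 ≤ u n) ∧ ((∀ᶠ n in atTop, u n = 0) ∨
    ∃ (d : ℕ) (l c : ℝ), 0 < l ∧ 0 < c ∧
      Tendsto (fun n => u n / binomGrowth d l n) atTop (𝓝 c))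

lemma Regular.congr_eventually {u v : ℕ → ℝ} (hu : Regular u) (hv : ∀ n, 0 ≤ v n)
    (h : ∀ᶠ n in atTop, u n = v n) : Regular v := by
  refine ⟨hv, hu.2.imp (fun h0 => ?_) ?_⟩
  · filter_upwards [h0, h] with n h1 h2
    rw [← h2, h1]
  · rintro ⟨d, l, c, hl, hc, ht⟩
    refine ⟨d, l, c, hl, hc, ht.congr' ?_⟩
    filter_upwards [h] with n hn
    rw [hn]

lemma Regular.add_of_tendsto_zero {u v : ℕ → ℝ} (hu : ∀ n, 0 ≤ u n) (hv : ∀ n, 0 ≤ v n)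
    {d e : ℕ} {l k c b : ℝ} (hl : 0 < l) (hc : 0 < c) (hk : 0 < k)
    (h1 : Tendsto (fun n => u n / binomGrowth d l n) atTop (𝓝 c))
    (h2 : Tendsto (fun n => v n / binomGrowth e k n) atTop (𝓝 b))
    (h : Tendsto (fun n => binomGrowth e k n / binomGrowth d l n) atTop (𝓝 0)) :
    Regular (fun n => u n + v n) := by
  refine ⟨fun n => add_nonneg (hu n) (hv n), .inr ⟨d, l, c, hl, hc, ?_⟩⟩
  have h3 := h1.add (h2.mul h)
  rw [mul_zero, add_zero] at h3
  refine h3.congr fun n => ?_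
  have := binomGrowth_pos e hk n
  field_simp

lemma Regular.add {u v : ℕ → ℝ} (hu : Regular u) (hv : Regular v) :
    Regular (fun n => u n + v n) := by
  obtain ⟨hu0, hu1⟩ := hu
  obtain ⟨hv0, hv1⟩ := hv
  have hnn : ∀ n, 0 ≤ u n + v n := fun n => add_nonneg (hu0 n) (hv0 n)
  rcases hu1 with hz | ⟨d, l, c, hl, hc, h1⟩
  · refine Regular.congr_eventually ⟨hv0, hv1⟩ hnn ?_
    filter_upwards [hz] with n hn
    rw [hn, zero_add]
  rcases hv1 with hz | ⟨e, k, b, hk, hb, h2⟩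
  · refine Regular.congr_eventually ⟨hu0, .inr ⟨d, l, c, hl, hc, h1⟩⟩ hnn ?_
    filter_upwards [hz] with n hn
    rw [hn, add_zero]
  rcases binomGrowth_trichotomy d e hl hk with ⟨rfl, rfl⟩ | h | h
  · refine ⟨hnn, .inr ⟨d, l, c + b, hl, by positivity, ?_⟩⟩
    refine (h1.add h2).congr fun n => ?_
    rw [add_div]
  · simpa only [add_comm] using Regular.add_of_tendsto_zero hv0 hu0 hk hb hl h2 h1 h
  · exact Regular.add_of_tendsto_zero hu0 hv0 hl hc hk h1 h2 h

lemma Regular.zero : Regular (fun _ => 0) :=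
  ⟨fun _ => le_rfl, .inl (Eventually.of_forall fun _ => rfl)⟩

lemma Regular.const_mul {u : ℕ → ℝ} (hu : Regular u) {a : ℝ} (ha : 0 ≤ a) :
    Regular (fun n => a * u n) := by
  rcases ha.eq_or_lt with rfl | ha
  · simpa using Regular.zero
  refine ⟨fun n => mul_nonneg ha.le (hu.1 n), hu.2.imp (fun h => ?_) ?_⟩
  · filter_upwards [h] with n hn
    rw [hn, mul_zero]
  · rintro ⟨d, l, c, hl, hc, h⟩
    refine ⟨d, l, a * c, hl, by positivity, (h.const_mul a).congr fun n => ?_⟩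
    rw [mul_div_assoc]

lemma Regular.affine {u : ℕ → ℝ} (hu : Regular u) {q : ℕ} (hq : 0 < q) (j : ℕ) :
    Regular (fun n => u (q * n + j)) := by
  have ht : Tendsto (fun n => q * n + j) atTop atTop :=
    tendsto_atTop_mono (fun n => (Nat.le_mul_of_pos_left n hq).trans (Nat.le_add_right _ j))
      tendsto_id
  refine ⟨fun n => hu.1 _, hu.2.imp (fun h => ht.eventually h) ?_⟩
  rintro ⟨d, l, c, hl, hc, h⟩
  refine ⟨d, l ^ q, c * ((q : ℝ) ^ d * l ^ j), by positivity, by positivity, ?_⟩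
  refine ((h.comp ht).mul (tendsto_binomGrowth_affine d hl q j)).congr fun n => ?_
  have := binomGrowth_pos d hl (q * n + j)
  simp only [Function.comp]
  field_simp

lemma tendsto_binomGrowth_sub (d : ℕ) {l : ℝ} (hl : 0 < l) (k : ℕ) :
    Tendsto (fun n => binomGrowth d l (n - k) * l ^ k / binomGrowth d l n) atTop (𝓝 1) := by
  rw [← tendsto_add_atTop_iff_nat k]
  have h := (tendsto_binomGrowth_affine d hl 1 k).inv₀ (by positivity)
  have h2 := h.mul_const (l ^ k)
  have h3 : (((1 : ℕ) : ℝ) ^ d * l ^ k)⁻¹ * l ^ k = 1 := by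
    rw [Nat.cast_one, one_pow, one_mul, inv_mul_cancel₀ (by positivity)]
  rw [h3] at h2
  refine h2.congr fun n => ?_
  rw [one_mul, pow_one, Nat.add_sub_cancel, inv_div]
  ring

lemma Regular.of_shift {u : ℕ → ℝ} (hu : ∀ n, 0 ≤ u n) (k : ℕ)
    (h : Regular (fun n => u (n + k))) : Regular u := by
  refine ⟨hu, h.2.imp (fun h => ?_) ?_⟩
  · obtain ⟨N, hN⟩ := eventually_atTop.1 h
    refine eventually_atTop.2 ⟨N + k, fun n hn => ?_⟩
    have : u (n - k + k) = 0 := hN (n - k) (by omega)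
    rwa [Nat.sub_add_cancel (by omega)] at this
  · rintro ⟨d, l, c, hl, hc, h⟩
    refine ⟨d, l, c * (l ^ k)⁻¹, hl, by positivity, ?_⟩
    rw [← tendsto_add_atTop_iff_nat k]
    have h2 := ((tendsto_add_atTop_iff_nat k).2 (tendsto_binomGrowth_sub d hl k)).mul_const
      (l ^ k)⁻¹
    rw [one_mul] at h2
    refine (h.mul h2).congr fun n => ?_
    have := binomGrowth_pos d hl n
    simp only [Nat.add_sub_cancel]
    field_simp

lemma binomGrowth_sub_le (d : ℕ) {l : ℝ} (hl : 0 < l) {n k : ℕ} (h : k ≤ n) :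
    binomGrowth d l (n - k) * l ^ k ≤ binomGrowth d l n := by
  unfold binomGrowth
  rw [mul_assoc, ← pow_add, Nat.sub_add_cancel h]
  gcongr
  omega

lemma exists_bound_of_tendsto {u : ℕ → ℝ} {d : ℕ} {l c : ℝ} (hl : 0 < l)
    (h : Tendsto (fun n => u n / binomGrowth d l n) atTop (𝓝 c)) :
    ∃ C, 0 ≤ C ∧ ∀ n, |u n| ≤ C * binomGrowth d l n := by
  obtain ⟨C, hC⟩ := h.abs.bddAbove_range
  have hC' : ∀ n, |u n / binomGrowth d l n| ≤ C := fun n => hC ⟨n, rfl⟩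
  refine ⟨C, (abs_nonneg _).trans (hC' 0), fun n => ?_⟩
  have h1 := hC' n
  have h2 := binomGrowth_pos d hl n
  rwa [abs_div, abs_of_pos h2, div_le_iff₀ h2] at h1

lemma tendsto_coeff_mul_zero {f g : ℝ⟦X⟧} {d e : ℕ} {l C : ℝ} (hl : 0 < l) (hC : 0 ≤ C)
    (hf : Tendsto (fun n => coeff n f / binomGrowth d l n) atTop (𝓝 0))
    (hg : ∀ n, |coeff n g| ≤ C * binomGrowth e l n) :
    Tendsto (fun n => coeff n (f * g) / binomGrowth (d + e + 1) l n) atTop (𝓝 0) := by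
  rw [Metric.tendsto_atTop]
  intro ε hε
  set η : ℝ := ε / (2 * (C + 1)) with hη
  have hη0 : 0 < η := by positivity
  obtain ⟨I, hI⟩ := Metric.tendsto_atTop.1 hf η hη0
  have hfb : ∀ k, |coeff k f| ≤ η * binomGrowth d l k + if k < I then |coeff k f| else 0 := by
    intro k
    have h2 := binomGrowth_pos d hl k
    split_ifs with hk
    · have : 0 ≤ η * binomGrowth d l k := by positivity
      linarith
    · have h1 := hI k (by omega)
      rw [Real.dist_eq, sub_zero, abs_div, abs_of_pos h2, div_lt_iff₀ h2] at h1
      linarith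
  set K : ℝ := ∑ k ∈ Finset.range I, |coeff k f| * C * (l ^ k)⁻¹ with hK
  have hbound : ∀ n, |coeff n (f * g)|
      ≤ η * C * binomGrowth (d + e + 1) l n + K * binomGrowth e l n := by
    intro n
    have h1 : ∑ k ∈ Finset.range (n + 1), binomGrowth d l k * binomGrowth e l (n - k)
        = binomGrowth (d + e + 1) l n := by
      have := congrArg (coeff n) (mk_binomGrowth_mul d e l)
      rw [coeff_mul_range] at this
      simpa using this
    calc |coeff n (f * g)|
        ≤ ∑ k ∈ Finset.range (n + 1), |coeff k f| * |coeff (n - k) g| := by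
          rw [coeff_mul_range]
          refine (Finset.abs_sum_le_sum_abs _ _).trans (le_of_eq ?_)
          exact Finset.sum_congr rfl fun k _ => abs_mul _ _
      _ ≤ ∑ k ∈ Finset.range (n + 1), (η * C * (binomGrowth d l k * binomGrowth e l (n - k))
            + if k < I then |coeff k f| * C * (l ^ k)⁻¹ * binomGrowth e l n else 0) := by
          refine Finset.sum_le_sum fun k hk => ?_
          have hkn : k ≤ n := by simpa [Nat.lt_succ_iff] using hk
          have h3 := binomGrowth_pos e hl (n - k)
          have h4 := binomGrowth_sub_le e hl hkn
          rw [← le_div_iff₀ (by positivity), div_eq_mul_inv] at h4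
          calc |coeff k f| * |coeff (n - k) g|
              ≤ (η * binomGrowth d l k + if k < I then |coeff k f| else 0)
                  * (C * binomGrowth e l (n - k)) :=
                mul_le_mul (hfb k) (hg _) (abs_nonneg _) ((abs_nonneg _).trans (hfb k))
            _ = η * C * (binomGrowth d l k * binomGrowth e l (n - k))
                + if k < I then |coeff k f| * C * binomGrowth e l (n - k) else 0 := by
                split_ifs <;> ring
            _ ≤ _ := by
                gcongr
                split_ifs
                · calc |coeff k f| * C * binomGrowth e l (n - k)
                      ≤ |coeff k f| * C * (binomGrowth e l n * (l ^ k)⁻¹) := by gcongr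
                    _ = _ := by ring
                · exact le_rfl
      _ ≤ _ := by
          rw [Finset.sum_add_distrib, ← Finset.mul_sum, h1, hK, Finset.sum_mul]
          gcongr
          rw [← Finset.sum_filter]
          refine Finset.sum_le_sum_of_subset_of_nonneg ?_ fun k _ _ => ?_
          · intro k hk
            simp only [Finset.mem_filter] at hk
            simpa using hk.2
          · have := binomGrowth_pos e hl n
            positivity
  have hlim := (tendsto_binomGrowth_div_of_degree_lt hl
    (show e < d + e + 1 by omega)).const_mul K
  rw [mul_zero] at hlim
  obtain ⟨N, hN⟩ := Metric.tendsto_atTop.1 hlim (ε / 2) (by positivity)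
  refine ⟨N, fun n hn => ?_⟩
  have h1 := hN n hn
  have h2 := binomGrowth_pos (d + e + 1) hl n
  rw [Real.dist_eq, sub_zero] at h1 ⊢
  rw [abs_div, abs_of_pos h2, div_lt_iff₀ h2]
  have h3 := (le_abs_self _).trans_lt h1
  rw [← mul_div_assoc, div_lt_iff₀ h2] at h3
  have h4 : η * C ≤ ε / 2 := by
    rw [hη, div_mul_eq_mul_div, div_le_div_iff₀ (by positivity) (by positivity)]
    nlinarith
  calc _ ≤ _ := hbound n
    _ < ε / 2 * binomGrowth (d + e + 1) l n + ε / 2 * binomGrowth (d + e + 1) l n :=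
      add_lt_add_of_le_of_lt (by gcongr) h3
    _ = _ := by ring

lemma tendsto_coeff_mul_of_same_rate {f g : ℝ⟦X⟧} {d e : ℕ} {l c b : ℝ} (hl : 0 < l)
    (hf : Tendsto (fun n => coeff n f / binomGrowth d l n) atTop (𝓝 c))
    (hg : Tendsto (fun n => coeff n g / binomGrowth e l n) atTop (𝓝 b)) :
    Tendsto (fun n => coeff n (f * g) / binomGrowth (d + e + 1) l n) atTop (𝓝 (c * b)) := by
  obtain ⟨C, hC, hgC⟩ := exists_bound_of_tendsto hl hg
  have hE : ∀ d (c : ℝ) (f : ℝ⟦X⟧), Tendsto (fun n => coeff n f / binomGrowth d l n) atTop (𝓝 c) →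
      Tendsto (fun n => coeff n (f - c • PowerSeries.mk (binomGrowth d l)) / binomGrowth d l n)
        atTop (𝓝 0) := by
    intro d c f h
    have h1 := h.sub_const c
    rw [sub_self] at h1
    refine h1.congr fun n => ?_
    have := binomGrowth_pos d hl n
    simp
    field_simp
  have h1 := tendsto_coeff_mul_zero hl hC (hE d c f hf) hgC
  have h2 := tendsto_coeff_mul_zero (f := g - b • PowerSeries.mk (binomGrowth e l))
    (g := c • PowerSeries.mk (binomGrowth d l)) (C := |c|) (d := e) (e := d) hl (abs_nonneg c)
    (hE e b g hg) (fun n => by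
      simp [abs_mul, abs_of_pos (binomGrowth_pos d hl n)])
  rw [add_comm e d] at h2
  have h3 := (h1.add h2).add_const (c * b)
  rw [add_zero, zero_add] at h3
  refine h3.congr fun n => ?_
  have h4 : f * g = (f - c • PowerSeries.mk (binomGrowth d l)) * g
      + (g - b • PowerSeries.mk (binomGrowth e l)) * c • PowerSeries.mk (binomGrowth d l)
      + (c * b) • PowerSeries.mk (binomGrowth (d + e + 1) l) := by
    rw [← mk_binomGrowth_mul]
    simp only [PowerSeries.smul_eq_C_mul, map_mul]
    ring
  have := binomGrowth_pos (d + e + 1) hl n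
  conv_rhs => rw [h4]
  simp only [map_add]
  simp only [map_smul, coeff_mk, smul_eq_mul]
  field_simp

lemma Regular.mul_of_rate_lt {f g : ℝ⟦X⟧} {d e : ℕ} {l k c b : ℝ} (hk : 0 < k) (h : k < l)
    (hc : 0 < c) (hb : 0 < b) (hf0 : ∀ n, 0 ≤ coeff n f) (hg0 : ∀ n, 0 ≤ coeff n g)
    (hf : Tendsto (fun n => coeff n f / binomGrowth d l n) atTop (𝓝 c))
    (hg : Tendsto (fun n => coeff n g / binomGrowth e k n) atTop (𝓝 b)) :
    Regular (fun n => coeff n (g * f)) := by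
  have hl : 0 < l := hk.trans h
  obtain ⟨B, hB, hfB⟩ := exists_bound_of_tendsto hl hf
  obtain ⟨C, hC, hgC⟩ := exists_bound_of_tendsto hk hg
  have hs : Summable fun i => coeff i g * (l ^ i)⁻¹ := by
    refine Summable.of_nonneg_of_le (fun i => mul_nonneg (hg0 i) (by positivity)) (fun i => ?_)
      ((summable_binomGrowth_mul_pow e hk (x := l⁻¹) (by positivity)
        (by rw [← div_eq_mul_inv, div_lt_one hl]; exact h)).mul_left C)
    rw [inv_pow, ← mul_assoc]
    gcongr
    exact (le_abs_self _).trans (hgC i)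
  obtain ⟨i, hi⟩ : ∃ i, 0 < coeff i g := by
    obtain ⟨i, hi⟩ := (hg.eventually_const_lt hb).exists
    exact ⟨i, (div_pos_iff_of_pos_right (binomGrowth_pos e hk i)).1 hi⟩
  refine ⟨fun n => ?_, .inr ⟨d, l, ∑' i, coeff i g * (l ^ i)⁻¹ * c, hl, ?_, ?_⟩⟩
  · simp only [coeff_mul_range]
    exact Finset.sum_nonneg fun i _ => mul_nonneg (hg0 _) (hf0 _)
  · refine (hs.mul_right c).tsum_pos (fun i => ?_) i (by positivity)
    have := hg0 i
    positivity
  · refine (tendsto_sum_range_mul le_rfl (B := B)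
      (x := fun n i => coeff (n - i) f * l ^ i / binomGrowth d l n) hs.abs ?_ ?_).congr ?_
    · intro n i hi
      have h1 := binomGrowth_pos d hl n
      rw [abs_div, abs_of_pos h1, div_le_iff₀ h1, abs_mul, abs_of_pos (by positivity : 0 < l ^ i)]
      calc |coeff (n - i) f| * l ^ i ≤ B * binomGrowth d l (n - i) * l ^ i := by
            gcongr
            exact hfB _
        _ = B * (binomGrowth d l (n - i) * l ^ i) := by ring
        _ ≤ _ := by
            gcongr
            exact binomGrowth_sub_le d hl hi
    · intro i
      have h1 := (hf.comp (tendsto_sub_atTop_nat i)).mul (tendsto_binomGrowth_sub d hl i)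
      rw [mul_one] at h1
      refine h1.congr fun n => ?_
      have := binomGrowth_pos d hl (n - i)
      simp only [Function.comp]
      field_simp
    · intro n
      simp only [coeff_mul_range, Finset.sum_div]
      refine Finset.sum_congr rfl fun i _ => ?_
      field_simp

lemma Regular.mul_of_finite (N : ℕ) : ∀ {f g : ℝ⟦X⟧}, (∀ n, 0 ≤ coeff n f) →
    (∀ n, N ≤ n → coeff n f = 0) → Regular (fun n => coeff n g) →
    Regular (fun n => coeff n (f * g)) := by
  induction N with
  | zero =>
    intro f g _ h _
    have : f = 0 := by
      ext n
      simpa using h n (Nat.zero_le n)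
    simpa [this] using Regular.zero
  | succ N ih =>
    intro f g h0 h hg
    set f' : ℝ⟦X⟧ := PowerSeries.mk fun p => coeff (p + 1) f with hf'
    have h1 : Regular (fun n => coeff n (f' * g)) :=
      ih (fun n => by simpa [hf'] using h0 (n + 1))
        (fun n hn => by simpa [hf'] using h (n + 1) (by omega)) hg
    have h2 : Regular (fun n => coeff n (X * (f' * g))) := by
      refine Regular.of_shift (fun n => ?_) 1 ?_
      · cases n with
        | zero => simp
        | succ n => simpa [coeff_succ_X_mul] using h1.1 n
      · simpa [coeff_succ_X_mul] using h1
    refine ((hg.const_mul (h0 0)).add h2).congr_eventually ?_ (Eventually.of_forall fun n => ?_)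
    · intro n
      rw [coeff_mul_range]
      exact Finset.sum_nonneg fun i _ => mul_nonneg (h0 _) (hg.1 _)
    · conv_rhs => rw [eq_X_mul_shift_add_const f]
      rw [add_mul, mul_assoc, map_add, coeff_C_mul, add_comm]
      simp [hf']

lemma Regular.mul {f g : ℝ⟦X⟧} (hf : Regular fun n => coeff n f) (hg : Regular fun n => coeff n g) :
    Regular (fun n => coeff n (f * g)) := by
  obtain ⟨hf0, hf1⟩ := hf
  obtain ⟨hg0, hg1⟩ := hg
  rcases hf1 with hz | ⟨d, l, c, hl, hc, h1⟩
  · obtain ⟨N, hN⟩ := eventually_atTop.1 hz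
    exact Regular.mul_of_finite N hf0 hN ⟨hg0, hg1⟩
  rcases hg1 with hz | ⟨e, k, b, hk, hb, h2⟩
  · obtain ⟨N, hN⟩ := eventually_atTop.1 hz
    rw [mul_comm]
    exact Regular.mul_of_finite N hg0 hN ⟨hf0, .inr ⟨d, l, c, hl, hc, h1⟩⟩
  rcases lt_trichotomy l k with h | rfl | h
  · exact Regular.mul_of_rate_lt hl h hb hc hg0 hf0 h2 h1
  · refine ⟨fun n => ?_, .inr ⟨d + e + 1, l, c * b, hl, by positivity,
      tendsto_coeff_mul_of_same_rate hl h1 h2⟩⟩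
    simp only [coeff_mul_range]
    exact Finset.sum_nonneg fun i _ => mul_nonneg (hf0 _) (hg0 _)
  · rw [mul_comm]
    exact Regular.mul_of_rate_lt hk h hc hb hf0 hg0 h1 h2

end Regular

section Renewal

open Topology PowerSeries

lemma renewal_clusterPt {p v r : ℕ → ℝ} {g : ℕ} (hg : 0 < g) (hp : ∀ k, 0 ≤ p k)
    (hsum : HasSum p 1) (hv : ∀ n, v n ∈ Set.Icc (0 : ℝ) 1)
    (hrec : ∀ n, 0 < n → v n = ∑ k ∈ Finset.range (n + 1), p k * v (n - k))
    (hgp : ∀ k, p k ≠ 0 → g ∣ k)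
    (hgen : ∃ M, ∀ m ≥ M, g ∣ m → m ∈ AddSubmonoid.closure {k | p k ≠ 0})
    (hgv : ∀ n, ¬ g ∣ n → v n = 0) (hr : Summable fun i => |r i|)
    (hrv : ∀ n, ∑ i ∈ Finset.range (n + 1), r i * v (n - i) = 1)
    {L σ : ℝ} (hσ : σ ≠ 0) (hL : MapClusterPt L (atTop ⊓ 𝓟 {n | g ∣ n}) v)
    (hext : ∀ y, MapClusterPt y (atTop ⊓ 𝓟 {n | g ∣ n}) v → 0 ≤ σ * (L - y)) :
    L * ∑' i, (if g ∣ i then r i else 0) = 1 := by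
  obtain ⟨U, hU, hUL⟩ := mapClusterPt_iff_ultrafilter.1 hL
  have hUtop : (U : Filter ℕ) ≤ atTop := hU.trans inf_le_left
  have hUg : ∀ᶠ n in (U : Filter ℕ), g ∣ n := hU (mem_inf_of_right (mem_principal_self _))
  have hsub : ∀ a : ℕ, map (fun n : ℕ => n - a) (U : Filter ℕ) ≤ atTop := fun a =>
    (map_mono hUtop).trans (tendsto_sub_atTop_nat a)
  have hex : ∀ a : ℕ, ∃ y, y ∈ Set.Icc (0 : ℝ) 1 ∧ Tendsto (fun n => v (n - a)) U (𝓝 y) := by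
    intro a
    obtain ⟨y, hy, hle⟩ := isCompact_Icc.ultrafilter_le_nhds (U.map fun n : ℕ => v (n - a))
      (s := Set.Icc (0 : ℝ) 1) (by
        rw [le_principal_iff]
        exact Ultrafilter.mem_map.2 (univ_mem' fun n : ℕ => hv (n - a)))
    exact ⟨y, hy, hle⟩
  choose w hw01 hw using hex
  have hwabs : ∀ a, |w a| ≤ 1 := fun a => by
    rw [abs_of_nonneg (hw01 a).1]
    exact (hw01 a).2
  have hvabs : ∀ a, |v a| ≤ 1 := fun a => by
    rw [abs_of_nonneg (hv a).1]
    exact (hv a).2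
  have hcluster : ∀ a, g ∣ a → MapClusterPt (w a) (atTop ⊓ 𝓟 {n | g ∣ n}) v := by
    intro a ha
    refine mapClusterPt_iff_ultrafilter.2 ⟨U.map fun n => n - a, le_inf (hsub a) ?_, ?_⟩
    · rw [le_principal_iff]
      exact hUg.mono fun n hn => Nat.dvd_sub hn ha
    · rw [Ultrafilter.coe_map, tendsto_map'_iff]
      exact hw a
  have hzero : ∀ a, ¬ g ∣ a → w a = 0 := by
    intro a ha
    refine tendsto_nhds_unique (hw a) (tendsto_const_nhds.congr' ?_)
    filter_upwards [hUg, hUtop (eventually_ge_atTop a)] with n hn hna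
    exact (hgv _ fun h => ha ((Nat.dvd_sub_iff_right hna hn).1 h)).symm
  have hshift : ∀ a k, Tendsto (fun m => v (m - k)) (map (fun n => n - a) (U : Filter ℕ))
      (𝓝 (w (a + k))) := by
    intro a k
    rw [tendsto_map'_iff]
    refine (hw (a + k)).congr fun n => ?_
    rw [Function.comp, Nat.sub_sub]
  have hself : ∀ a, Tendsto v (map (fun n => n - a) (U : Filter ℕ)) (𝓝 (w a)) := fun a =>
    hshift a 0
  have hconv : ∀ a, HasSum (fun k => p k * w (a + k)) (w a) := by
    intro a
    have hs : Summable fun k => p k * w (a + k) :=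
      Summable.of_norm_bounded hsum.summable fun k => by
        rw [Real.norm_eq_abs, abs_mul, abs_of_nonneg (hp k)]
        exact mul_le_of_le_one_right (hp k) (hwabs _)
    have h1 := tendsto_sum_range_mul (hsub a) hsum.summable.abs (x := fun n k => v (n - k))
      (fun n k _ => hvabs _) (hshift a)
    have h2 := tendsto_nhds_unique (hself a) (h1.congr' ?_)
    · rw [h2]
      exact hs.hasSum
    · filter_upwards [hsub a (eventually_gt_atTop 0)] with n hn
      exact (hrec n hn).symm
  have hstep : ∀ k ∈ AddSubmonoid.closure {k | p k ≠ 0}, ∀ a,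
      g ∣ a ∧ w a = L → g ∣ a + k ∧ w (a + k) = L := by
    intro k hk
    induction hk using AddSubmonoid.closure_induction with
    | mem k hk =>
      rintro a ⟨hga, hwa⟩
      have h1 : HasSum (fun k => p k * (σ * (L - w (a + k)))) 0 := by
        have h2 := ((hsum.mul_right L).sub (hconv a)).mul_left σ
        rw [one_mul, hwa, sub_self, mul_zero] at h2
        refine h2.congr_fun fun k => ?_
        ring
      have h3 := (hasSum_zero_iff_of_nonneg (fun k => by
        by_cases hk : p k = 0
        · simp [hk]
        · exact mul_nonneg (hp k) (hext _ (hcluster _ (hga.add (hgp k hk)))))).1 h1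
      have h4 := congrFun h3 k
      simp only [Pi.zero_apply, mul_eq_zero, hσ, false_or] at h4
      exact ⟨hga.add (hgp k hk), by linarith [h4.resolve_left hk]⟩
    | zero => exact fun a h => h
    | add x y _ _ hx hy =>
      intro a h
      rw [← add_assoc]
      exact hy _ (hx _ h)
  obtain ⟨M, hM⟩ := hgen
  have hw0 : g ∣ 0 ∧ w 0 = L := ⟨dvd_zero g, tendsto_nhds_unique (hw 0) hUL⟩
  have hlarge : ∀ m ≥ M, g ∣ m → w m = L := by
    intro m hm hgm
    have := (hstep m (hM m hm hgm) 0 hw0).2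
    rwa [zero_add] at this
  have h1 := tendsto_sum_range_mul (hsub (g * M)) hr (x := fun n k => v (n - k))
    (fun n k _ => hvabs _) (hshift (g * M))
  simp only [hrv] at h1
  have h2 := tendsto_nhds_unique h1 tendsto_const_nhds
  rw [← h2, ← tsum_mul_left]
  refine tsum_congr fun i => ?_
  split_ifs with hi
  · rw [hlarge _ _ ((dvd_mul_right g M).add hi), mul_comm]
    exact (Nat.le_mul_of_pos_left M hg).trans (Nat.le_add_right _ _)
  · rw [hzero _ fun h => hi ((Nat.dvd_add_right (dvd_mul_right g M)).1 h), mul_zero, mul_zero]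

/-- The renewal theorem for step distributions with an exponential tail. -/
theorem renewal_tendsto {p v : ℝ⟦X⟧} (hp : ∀ n, 0 ≤ coeff n p) (h0 : coeff 0 p = 0)
    (hsum : HasSum (fun n => coeff n p) 1) {x : ℝ} (hx : 1 < x)
    (hs : Summable fun n => coeff n p * x ^ n) (hv : v * (1 - p) = 1) :
    ∃ g : ℕ, 0 < g ∧ ∃ c : ℝ, 0 < c ∧ (∀ n, 0 ≤ coeff n v) ∧
      (∀ n, ¬ g ∣ n → coeff n v = 0) ∧ Tendsto (fun m => coeff (g * m) v) atTop (𝓝 c) := by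
  have hrec : ∀ n, 0 < n →
      coeff n v = ∑ k ∈ Finset.range (n + 1), coeff k p * coeff (n - k) v := by
    intro n hn
    have h1 : v = 1 + p * v := by linear_combination hv
    conv_lhs => rw [h1]
    rw [map_add, coeff_mul_range, coeff_one, if_neg hn.ne', zero_add]
  have hv0 : coeff 0 v = 1 := by
    have := congrArg (coeff 0) hv
    rw [coeff_mul_range] at this
    simpa only [zero_add, Finset.sum_range_one, Nat.sub_zero, map_sub, h0, coeff_zero_one, sub_zero,
      mul_one] using this
  have hpartial : ∀ n, ∑ k ∈ Finset.range n, coeff k p ≤ 1 := fun n =>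
    sum_le_hasSum _ (fun k _ => hp k) hsum
  have hv01 : ∀ n, coeff n v ∈ Set.Icc (0 : ℝ) 1 := by
    intro n
    induction n using Nat.strong_induction_on with
    | _ n ih =>
      rcases n.eq_zero_or_pos with rfl | hn
      · simp [hv0]
      have hterm : ∀ k ∈ Finset.range (n + 1), 0 ≤ coeff k p * coeff (n - k) v ∧
          coeff k p * coeff (n - k) v ≤ coeff k p := by
        intro k _
        rcases k.eq_zero_or_pos with rfl | hk
        · simp [h0]
        · have := ih (n - k) (by omega)
          exact ⟨mul_nonneg (hp k) this.1, mul_le_of_le_one_right (hp k) this.2⟩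
      rw [hrec n hn]
      exact ⟨Finset.sum_nonneg fun k hk => (hterm k hk).1,
        (Finset.sum_le_sum fun k hk => (hterm k hk).2).trans (hpartial _)⟩
  set g : ℕ := Nat.setGcd {k | coeff k p ≠ 0} with hgdef
  have hgp : ∀ k, coeff k p ≠ 0 → g ∣ k := fun k hk => Nat.setGcd_dvd_of_mem hk
  have hg : 0 < g := by
    refine Nat.pos_of_ne_zero fun h => ?_
    rw [hgdef, Nat.setGcd_eq_zero_iff] at h
    have hz : (fun n => coeff n p) = 0 := by
      funext k
      by_contra hk
      have : k = 0 := h hk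
      exact hk (by rw [this]; exact h0)
    rw [hz] at hsum
    exact zero_ne_one (hasSum_zero.unique hsum)
  have hgv : ∀ n, ¬ g ∣ n → coeff n v = 0 := by
    intro n
    induction n using Nat.strong_induction_on with
    | _ n ih =>
      intro hn
      have hn0 : 0 < n := Nat.pos_of_ne_zero fun h => hn (h ▸ dvd_zero g)
      rw [hrec n hn0]
      refine Finset.sum_eq_zero fun k hk => ?_
      have hkn : k ≤ n := by simpa [Nat.lt_succ_iff] using hk
      by_cases hpk : coeff k p = 0
      · rw [hpk, zero_mul]
      · have hk0 : k ≠ 0 := fun h => hpk (h ▸ h0)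
        rw [ih (n - k) (by omega) fun h => hn ?_, mul_zero]
        have := h.add (hgp k hpk)
        rwa [Nat.sub_add_cancel hkn] at this
  set r : ℝ⟦X⟧ := (1 - p) * PowerSeries.mk 1 with hrdef
  have hrc : ∀ n, coeff n r = 1 - ∑ k ∈ Finset.range (n + 1), coeff k p := by
    intro n
    rw [hrdef, sub_mul, one_mul, map_sub, coeff_mul_range]
    simp
  have hr0 : ∀ n, 0 ≤ coeff n r := fun n => by
    rw [hrc]
    linarith [hpartial (n + 1)]
  have hrsum : Summable fun i => |coeff i r| := by
    refine Summable.of_nonneg_of_le (fun i => abs_nonneg _) (fun i => ?_)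
      ((summable_geometric_of_lt_one (r := x⁻¹) (by positivity) (inv_lt_one_of_one_lt₀ hx)).mul_left
        (∑' n, coeff n p * x ^ n))
    rw [abs_of_nonneg (hr0 i), inv_pow, ← div_eq_mul_inv, le_div_iff₀ (by positivity), hrc,
      ← hsum.tsum_eq, ← hsum.summable.sum_add_tsum_nat_add (i + 1), add_sub_cancel_left,
      ← tsum_mul_right]
    have hs' := (summable_nat_add_iff (i + 1)).2 hs
    calc ∑' k, coeff (k + (i + 1)) p * x ^ i
        ≤ ∑' k, coeff (k + (i + 1)) p * x ^ (k + (i + 1)) := by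
          refine Summable.tsum_le_tsum (fun k => ?_)
            (((summable_nat_add_iff (i + 1)).2 hsum.summable).mul_right _) hs'
          have := hp (k + (i + 1))
          gcongr
          · exact hx.le
          · omega
      _ ≤ ∑' k, coeff k p * x ^ k := by
          rw [← hs.sum_add_tsum_nat_add (i + 1)]
          refine le_add_of_nonneg_left (Finset.sum_nonneg fun k _ => ?_)
          have := hp k
          positivity
  have hrv : ∀ n, ∑ i ∈ Finset.range (n + 1), coeff i r * coeff (n - i) v = 1 := by
    intro n
    have h1 : r * v = PowerSeries.mk 1 := by
      rw [hrdef]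
      linear_combination (PowerSeries.mk (1 : ℕ → ℝ)) * hv
    rw [← coeff_mul_range, h1]
    simp
  set F : Filter ℕ := atTop ⊓ 𝓟 {n | g ∣ n} with hF
  have htend : Tendsto (fun m => g * m) atTop F := by
    refine tendsto_inf.2 ⟨tendsto_atTop_mono (fun n => Nat.le_mul_of_pos_left n hg) tendsto_id, ?_⟩
    exact tendsto_principal.2 (Eventually.of_forall fun m => dvd_mul_right g m)
  have hFne : F.NeBot := htend.neBot
  have hmem : ∀ y, MapClusterPt y F (fun n => coeff n v) → y ∈ Set.Icc (0 : ℝ) 1 := by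
    intro y hy
    exact isClosed_Icc.mem_of_mapClusterPt hy (Eventually.of_forall hv01)
  have hK : IsCompact {y | MapClusterPt y F (fun n => coeff n v)} :=
    isCompact_Icc.of_isClosed_subset isClosed_setOfPred_clusterPt hmem
  have hKne : {y | MapClusterPt y F (fun n => coeff n v)}.Nonempty := by
    obtain ⟨y, _, hy⟩ := isCompact_Icc.exists_mapClusterPt (f := F) (u := fun n => coeff n v)
      (tendsto_principal.2 (Eventually.of_forall hv01))
    exact ⟨y, hy⟩
  obtain ⟨L₁, hL₁, hmin⟩ := hK.exists_isLeast hKne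
  obtain ⟨L₂, hL₂, hmax⟩ := hK.exists_isGreatest hKne
  have hgen : ∃ M, ∀ m ≥ M, g ∣ m → m ∈ AddSubmonoid.closure {k | coeff k p ≠ 0} :=
    Nat.exists_mem_closure_of_ge _
  have e₁ := renewal_clusterPt hg hp hsum hv01 hrec hgp hgen hgv hrsum hrv (L := L₁) (σ := -1)
    (by norm_num) hL₁ fun y hy => by linarith [hmin hy]
  have e₂ := renewal_clusterPt hg hp hsum hv01 hrec hgp hgen hgv hrsum hrv (L := L₂) (σ := 1)
    (by norm_num) hL₂ fun y hy => by linarith [hmax hy]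
  have hne : (∑' i, if g ∣ i then coeff i r else 0) ≠ 0 := fun h => by
    rw [h, mul_zero] at e₁
    exact zero_ne_one e₁
  have hLL : L₁ = L₂ := mul_right_cancel₀ hne (e₁.trans e₂.symm)
  have hL0 : L₁ ≠ 0 := fun h => by
    rw [h, zero_mul] at e₁
    exact zero_ne_one e₁
  refine ⟨g, hg, L₁, lt_of_le_of_ne (hmem _ hL₁).1 hL0.symm, fun n => (hv01 n).1, hgv, ?_⟩
  refine Tendsto.comp (g := fun n => coeff n v) ?_ htend
  refine isCompact_Icc.tendsto_nhds_of_unique_mapClusterPt (Eventually.of_forall hv01)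
    fun y _ hy => le_antisymm ?_ (hmin hy)
  rw [hLL]
  exact hmax hy

end Renewal

section Tame

open Topology PowerSeries

/-- All sections of the coefficient sequence along progressions modulo `p` are regular. -/
def TameAt (p : ℕ) (f : ℝ⟦X⟧) : Prop := ∀ r, Regular fun m => coeff (p * m + r) f

/-- The coefficient sequence is regular along the progressions of some modulus. -/
def Tame (f : ℝ⟦X⟧) : Prop := ∃ p, 0 < p ∧ TameAt p f

lemma Tame.coeff_nonneg {f : ℝ⟦X⟧} (hf : Tame f) (n : ℕ) : 0 ≤ coeff n f := by
  obtain ⟨p, -, h⟩ := hf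
  simpa using (h n).1 0

lemma TameAt.mul_left {p : ℕ} {f : ℝ⟦X⟧} (hf : TameAt p f) {q : ℕ} (hq : 0 < q) :
    TameAt (p * q) f := by
  intro r
  simpa only [add_zero, mul_assoc] using (hf r).affine hq 0

lemma Tame.exists_common {f g : ℝ⟦X⟧} (hf : Tame f) (hg : Tame g) :
    ∃ p, 0 < p ∧ TameAt p f ∧ TameAt p g := by
  obtain ⟨p, hp, hf⟩ := hf
  obtain ⟨q, hq, hg⟩ := hg
  exact ⟨p * q, Nat.mul_pos hp hq, hf.mul_left hq, mul_comm p q ▸ hg.mul_left hp⟩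

lemma TameAt.add {p : ℕ} {f g : ℝ⟦X⟧} (hf : TameAt p f) (hg : TameAt p g) :
    TameAt p (f + g) := by
  intro r
  simpa only [map_add] using (hf r).add (hg r)

lemma Tame.add {f g : ℝ⟦X⟧} (hf : Tame f) (hg : Tame g) : Tame (f + g) := by
  obtain ⟨p, hp, hf, hg⟩ := hf.exists_common hg
  exact ⟨p, hp, hf.add hg⟩

lemma tame_of_finite {f : ℝ⟦X⟧} (h0 : ∀ n, 0 ≤ coeff n f) (N : ℕ)
    (h : ∀ n, N ≤ n → coeff n f = 0) : Tame f := by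
  refine ⟨1, one_pos, fun r => ⟨fun m => h0 _, .inl ?_⟩⟩
  filter_upwards [eventually_ge_atTop N] with m hm
  exact h _ (by omega)

lemma Tame.zero : Tame 0 := tame_of_finite (by simp) 0 (by simp)

lemma TameAt.zero (p : ℕ) : TameAt p 0 := fun r => by simpa using Regular.zero

lemma Tame.one : Tame 1 := by
  refine tame_of_finite (fun n => ?_) 1 fun n hn => ?_
  · rw [coeff_one]
    split_ifs <;> norm_num
  · rw [coeff_one, if_neg (by omega)]

lemma Tame.C_mul_X {a : ℝ} (ha : 0 ≤ a) : Tame (C a * X) := by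
  refine tame_of_finite (fun n => ?_) 2 fun n hn => ?_
  · rw [coeff_C_mul, coeff_X]
    split_ifs <;> simp [ha]
  · rw [coeff_C_mul, coeff_X, if_neg (by omega), mul_zero]

lemma Tame.sum {ι : Type*} (s : Finset ι) {f : ι → ℝ⟦X⟧} (h : ∀ i ∈ s, Tame (f i)) :
    Tame (∑ i ∈ s, f i) := by
  classical
  induction s using Finset.induction_on with
  | empty => simpa using Tame.zero
  | insert a s ha ih =>
    rw [Finset.sum_insert ha]
    exact (h a (by simp)).add (ih fun i hi => h i (by simp [hi]))

lemma TameAt.sum {ι : Type*} {p : ℕ} (s : Finset ι) {f : ι → ℝ⟦X⟧} (h : ∀ i ∈ s, TameAt p (f i)) :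
    TameAt p (∑ i ∈ s, f i) := by
  classical
  induction s using Finset.induction_on with
  | empty => simpa using TameAt.zero p
  | insert a s ha ih =>
    rw [Finset.sum_insert ha]
    exact (h a (by simp)).add (ih fun i hi => h i (by simp [hi]))

lemma tameAt_X_pow_mul_expand {p : ℕ} (hp : p ≠ 0) (c : ℕ) {s : ℝ⟦X⟧}
    (hs : Regular fun n => coeff n s) : TameAt p (X ^ c * expand p hp s) := by
  have hcp : c ≤ p * c := Nat.le_mul_of_pos_left c (Nat.pos_of_ne_zero hp)
  have hnn : ∀ n, 0 ≤ coeff n (X ^ c * expand p hp s) := by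
    intro n
    rw [coeff_X_pow_mul', coeff_expand]
    split_ifs
    · exact hs.1 _
    · exact le_rfl
    · exact le_rfl
  intro r
  refine Regular.of_shift (fun m => hnn _) c ?_
  have hval : ∀ m, coeff (p * (m + c) + r) (X ^ c * expand p hp s)
      = if p ∣ p * c + r - c then coeff (m + (p * c + r - c) / p) s else 0 := by
    intro m
    have h1 : c ≤ p * (m + c) + r := by
      rw [mul_add]
      omega
    have h2 : p * (m + c) + r - c = p * m + (p * c + r - c) := by
      rw [mul_add]
      omega
    rw [coeff_X_pow_mul', if_pos h1, coeff_expand, h2]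
    simp only [Nat.dvd_add_right (dvd_mul_right p m)]
    split_ifs with h
    · rw [Nat.mul_add_div (Nat.pos_of_ne_zero hp)]
    · rfl
  simp only [hval]
  split_ifs with h
  · simpa only [one_mul] using hs.affine one_pos ((p * c + r - c) / p)
  · exact Regular.zero

lemma eq_sum_X_pow_mul_expand {p : ℕ} (hp : p ≠ 0) (f : ℝ⟦X⟧) :
    f = ∑ a ∈ Finset.range p,
      X ^ a * expand p hp (PowerSeries.mk fun m => coeff (p * m + a) f) := by
  ext n
  have hmod : n % p < p := Nat.mod_lt n (Nat.pos_of_ne_zero hp)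
  rw [map_sum, Finset.sum_eq_single (n % p)]
  · rw [coeff_X_pow_mul', if_pos (Nat.mod_le n p), coeff_expand, if_pos (Nat.dvd_sub_mod n),
      coeff_mk, Nat.mul_div_cancel' (Nat.dvd_sub_mod n), Nat.sub_add_cancel (Nat.mod_le n p)]
  · intro a ha hne
    rw [coeff_X_pow_mul', coeff_expand]
    split_ifs with h1 h2
    · refine absurd ?_ hne
      have h3 := (Nat.modEq_iff_dvd' h1).2 h2
      rw [← Nat.mod_eq_of_lt (Finset.mem_range.1 ha)]
      exact h3
    · rfl
    · rfl
  · intro h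
    exact absurd (Finset.mem_range.2 hmod) h

lemma Tame.mul {f g : ℝ⟦X⟧} (hf : Tame f) (hg : Tame g) : Tame (f * g) := by
  obtain ⟨p, hp, hf, hg⟩ := hf.exists_common hg
  refine ⟨p, hp, ?_⟩
  rw [eq_sum_X_pow_mul_expand hp.ne' f, eq_sum_X_pow_mul_expand hp.ne' g, Finset.sum_mul_sum]
  refine TameAt.sum _ fun a _ => TameAt.sum _ fun b _ => ?_
  rw [mul_mul_mul_comm, ← pow_add, ← map_mul]
  refine tameAt_X_pow_mul_expand hp.ne' _ (Regular.mul ?_ ?_)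
  · simpa only [coeff_mk] using hf a
  · simpa only [coeff_mk] using hg b

lemma Regular.eventually_summable {u : ℕ → ℝ} (hu : Regular u) {x : ℝ} (hx : 0 ≤ x)
    (h : Summable fun n => u n * x ^ n) : ∀ᶠ y in 𝓝[>] x, Summable fun n => u n * y ^ n := by
  obtain ⟨h0, hz | ⟨d, l, c, hl, hc, ht⟩⟩ := hu
  · obtain ⟨N, hN⟩ := eventually_atTop.1 hz
    refine Eventually.of_forall fun y => summable_of_ne_finset_zero (s := Finset.range N) ?_
    intro n hn
    rw [hN n (by simpa using hn), zero_mul]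
  · have hlx : l * x < 1 := by
      by_contra! hge
      have h1 := h.tendsto_atTop_zero.eventually_lt_const (half_pos hc)
      obtain ⟨n, hn1, hn2⟩ := (h1.and (ht.eventually_const_lt (half_lt_self hc))).exists
      have hE := binomGrowth_pos d hl n
      rw [lt_div_iff₀ hE] at hn2
      have h2 : 1 ≤ binomGrowth d l n * x ^ n := by
        rw [binomGrowth, mul_assoc, ← mul_pow]
        exact one_le_mul_of_one_le_of_one_le (one_le_choose_add d n) (one_le_pow₀ hge)
      have h3 : c / 2 * binomGrowth d l n * x ^ n ≤ u n * x ^ n := by gcongr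
      nlinarith
    obtain ⟨K, hK, hb⟩ := exists_bound_of_tendsto hl ht
    have hcont : ∀ᶠ y in 𝓝 x, l * y < 1 :=
      (continuous_const.mul continuous_id).continuousAt.eventually_lt continuousAt_const hlx
    filter_upwards [nhdsWithin_le_nhds hcont, self_mem_nhdsWithin] with y hy hxy
    have hy0 : 0 ≤ y := hx.trans (le_of_lt hxy)
    refine Summable.of_nonneg_of_le (fun n => mul_nonneg (h0 n) (by positivity)) (fun n => ?_)
      ((summable_binomGrowth_mul_pow d hl hy0 hy).mul_left K)
    rw [← mul_assoc]
    gcongr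
    exact (le_abs_self _).trans (hb n)

lemma summable_of_sections {p : ℕ} (hp : 0 < p) {u : ℕ → ℝ}
    (h : ∀ r ∈ Finset.range p, Summable fun m => u (p * m + r)) : Summable u := by
  have h1 : ∀ r ∈ Finset.range p, Summable fun n => if n % p = r then u n else 0 := by
    intro r hr
    have hr' := Finset.mem_range.1 hr
    have hinj : Function.Injective fun m => p * m + r := fun a b hab =>
      Nat.eq_of_mul_eq_mul_left hp (Nat.add_right_cancel hab)
    rw [← hinj.summable_iff]
    · refine (h r hr).congr fun m => ?_
      simp [Nat.mod_eq_of_lt hr']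
    · intro n hn
      rw [if_neg]
      rintro rfl
      exact hn ⟨n / p, Nat.div_add_mod n p⟩
  refine (summable_sum h1).congr fun n => ?_
  rw [Finset.sum_ite_eq, if_pos (Finset.mem_range.2 (Nat.mod_lt n hp))]

lemma Tame.eventually_summable {f : ℝ⟦X⟧} (hf : Tame f) {x : ℝ} (hx : 0 ≤ x)
    (h : Summable fun n => coeff n f * x ^ n) :
    ∀ᶠ y in 𝓝[>] x, Summable fun n => coeff n f * y ^ n := by
  obtain ⟨p, hp, hf⟩ := hf
  have hpow : Tendsto (fun y : ℝ => y ^ p) (𝓝[>] x) (𝓝[>] (x ^ p)) := by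
    refine tendsto_nhdsWithin_iff.2
      ⟨((continuous_pow p).tendsto x).mono_left nhdsWithin_le_nhds, ?_⟩
    filter_upwards [self_mem_nhdsWithin] with y hy
    exact pow_lt_pow_left₀ hy hx hp.ne'
  have h1 : ∀ r ∈ Finset.range p, ∀ᶠ y in 𝓝[>] x,
      Summable fun m => coeff (p * m + r) f * (y ^ p) ^ m := by
    intro r _
    refine hpow.eventually ((hf r).eventually_summable (by positivity) ?_)
    rcases hx.eq_or_lt with rfl | hx
    · refine summable_of_ne_finset_zero (s := {0}) fun m hm => ?_
      rw [zero_pow hp.ne', zero_pow (by simpa using hm), mul_zero]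
    · have hinj : Function.Injective fun m => p * m + r := fun a b hab =>
        Nat.eq_of_mul_eq_mul_left hp (Nat.add_right_cancel hab)
      refine ((h.comp_injective hinj).mul_right (x ^ r)⁻¹).congr fun m => ?_
      simp only [Function.comp]
      rw [pow_add, pow_mul]
      field_simp
  filter_upwards [(eventually_all_finset _).2 h1] with y hy
  refine summable_of_sections hp fun r hr => ((hy r hr).mul_right (y ^ r)).congr fun m => ?_
  rw [pow_add, pow_mul]
  ring

lemma Tame.exists_hasSum_one {f : ℝ⟦X⟧} (hf : Tame f) (h0 : coeff 0 f = 0) (hne : f ≠ 0) :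
    ∃ s t : ℝ, 0 < s ∧ s < t ∧ HasSum (fun n => coeff n f * s ^ n) 1 ∧
      Summable fun n => coeff n f * t ^ n := by
  have hnn := hf.coeff_nonneg
  set A : Set ℝ := {x | 0 ≤ x ∧ (Summable fun n => coeff n f * x ^ n) ∧
    ∑' n, coeff n f * x ^ n ≤ 1} with hA
  have hzero : ∀ n, coeff n f * (0 : ℝ) ^ n = 0 := by
    intro n
    rcases n.eq_zero_or_pos with rfl | hn
    · rw [h0, zero_mul]
    · rw [zero_pow hn.ne', mul_zero]
  have hA0 : (0 : ℝ) ∈ A := by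
    refine ⟨le_rfl, ?_, ?_⟩
    · simp only [hzero]
      exact summable_zero
    · simp [hzero]
  obtain ⟨k, hk⟩ : ∃ k, coeff k f ≠ 0 := by
    by_contra! h
    exact hne (PowerSeries.ext (by simpa using h))
  have hk0 : k ≠ 0 := fun h => hk (h ▸ h0)
  have hkpos : 0 < coeff k f := lt_of_le_of_ne (hnn k) hk.symm
  have hbdd : BddAbove A := by
    refine ⟨max 1 (coeff k f)⁻¹, fun x hx => ?_⟩
    obtain ⟨hx0, hxs, hx1⟩ := hx
    rcases le_total x 1 with h | h
    · exact h.trans (le_max_left _ _)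
    · refine le_trans ?_ (le_max_right _ _)
      have h2 : coeff k f * x ^ k ≤ 1 :=
        (hxs.le_tsum k fun n _ => mul_nonneg (hnn n) (by positivity)).trans hx1
      have h3 : x ≤ x ^ k := le_self_pow₀ h hk0
      rw [← one_div, le_div_iff₀ hkpos]
      nlinarith
  set s := sSup A with hs
  have hs0 : 0 ≤ s := le_csSup hbdd hA0
  have hpart : ∀ N, ∑ n ∈ Finset.range N, coeff n f * s ^ n ≤ 1 := by
    intro N
    have hcl : IsClosed {x : ℝ | ∑ n ∈ Finset.range N, coeff n f * x ^ n ≤ 1} :=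
      isClosed_le (by fun_prop) continuous_const
    refine hcl.closure_subset_iff.2 (fun x hx => ?_) (csSup_mem_closure ⟨0, hA0⟩ hbdd)
    have hx0 := hx.1
    exact (hx.2.1.sum_le_tsum _ fun n _ => mul_nonneg (hnn n) (by positivity)).trans hx.2.2
  have hterm : ∀ n, 0 ≤ coeff n f * s ^ n := fun n => mul_nonneg (hnn n) (by positivity)
  have hsum : Summable fun n => coeff n f * s ^ n := summable_of_sum_range_le hterm hpart
  have hle : ∑' n, coeff n f * s ^ n ≤ 1 := Real.tsum_le_of_sum_range_le hterm hpart
  obtain ⟨t, ht, hst⟩ := ((hf.eventually_summable hs0 hsum).and self_mem_nhdsWithin).exists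
  have hst : s < t := hst
  have hcont : ContinuousOn (fun x => ∑' n, coeff n f * x ^ n) (Set.Icc 0 t) := by
    refine continuousOn_tsum (fun n => by fun_prop) ht fun n x hx => ?_
    have hx0 : 0 ≤ x := hx.1
    rw [Real.norm_of_nonneg (mul_nonneg (hnn n) (by positivity))]
    gcongr
    · exact hnn n
    · exact hx.2
  have heq : ∑' n, coeff n f * s ^ n = 1 := by
    by_contra hne1
    have hlt := lt_of_le_of_ne hle hne1
    have h1 : ∀ᶠ y in 𝓝[Set.Icc 0 t] s, ∑' n, coeff n f * y ^ n < 1 :=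
      (hcont s ⟨hs0, hst.le⟩).eventually_lt continuousWithinAt_const hlt
    have h2 : 𝓝[Set.Ioo s t] s ≤ 𝓝[Set.Icc 0 t] s :=
      nhdsWithin_mono _ fun y hy => ⟨hs0.trans hy.1.le, hy.2.le⟩
    rw [nhdsWithin_Ioo_eq_nhdsGT hst] at h2
    have h3 : ∀ᶠ y in 𝓝[>] s, ∑' n, coeff n f * y ^ n < 1 := h2 h1
    obtain ⟨y, ⟨hy1, hy2⟩, hy3⟩ :=
      ((h3.and (hf.eventually_summable hs0 hsum)).and self_mem_nhdsWithin).exists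
    have hy3 : s < y := hy3
    exact absurd (le_csSup hbdd (show y ∈ A from ⟨hs0.trans hy3.le, hy2, le_of_lt hy1⟩))
      (not_le.2 hy3)
  refine ⟨s, t, lt_of_le_of_ne hs0 fun h => ?_, hst, heq ▸ hsum.hasSum, ht⟩
  rw [← h] at heq
  simp [hzero] at heq

lemma Tame.of_mul_one_sub_eq_one {f v : ℝ⟦X⟧} (hf : Tame f) (h0 : coeff 0 f = 0)
    (hv : v * (1 - f) = 1) : Tame v := by
  by_cases hne : f = 0
  · rw [hne, sub_zero, mul_one] at hv
    rw [hv]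
    exact Tame.one
  obtain ⟨s, t, hs, hst, hsum, ht⟩ := hf.exists_hasSum_one h0 hne
  obtain ⟨g, hg, c, hc, hnn, hz, hlim⟩ := renewal_tendsto (p := rescale s f) (v := rescale s v)
    (x := t / s) (fun n => by
      rw [coeff_rescale]
      exact mul_nonneg (by positivity) (hf.coeff_nonneg n))
    (by rw [coeff_rescale, h0, mul_zero])
    (by simpa only [coeff_rescale, mul_comm] using hsum)
    ((one_lt_div hs).2 hst)
    (ht.congr fun n => by
      rw [coeff_rescale, div_pow]
      field_simp)
    (by rw [← map_one (rescale s), ← map_sub, ← map_mul, hv])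
  simp only [coeff_rescale] at hnn hz hlim
  have hv0 : ∀ n, 0 ≤ coeff n v := fun n => by
    have := hnn n
    exact (mul_nonneg_iff_of_pos_left (by positivity)).1 this
  refine ⟨g, hg, fun r => ?_⟩
  by_cases hr : g ∣ r
  · obtain ⟨j, rfl⟩ := hr
    have hreg : Regular fun m => coeff (g * m) v := by
      refine ⟨fun m => hv0 _, .inr ⟨0, (s ^ g)⁻¹, c, by positivity, hc, hlim.congr fun m => ?_⟩⟩
      simp [binomGrowth, pow_mul, mul_comm]
    simpa only [one_mul, mul_add] using hreg.affine one_pos j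
  · refine ⟨fun m => hv0 _, .inl (Eventually.of_forall fun m => ?_)⟩
    have h1 := hz (g * m + r) fun h => hr ((Nat.dvd_add_right (dvd_mul_right g m)).1 h)
    exact (mul_eq_zero.1 h1).resolve_left (by positivity)

/-- Tameness of the solution of a linear system with tame coefficients, by elimination. -/
theorem tame_of_linear_system {ι : Type*} [DecidableEq ι] (A : Finset ι) :
    ∀ (b : ι → ℝ⟦X⟧) (c : ι → ι → ℝ⟦X⟧) (y : ι → ℝ⟦X⟧), (∀ i ∈ A, Tame (b i)) →
      (∀ i ∈ A, ∀ k ∈ A, Tame (c i k) ∧ coeff 0 (c i k) = 0) →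
      (∀ i ∈ A, y i = b i + ∑ k ∈ A, c i k * y k) → ∀ i ∈ A, Tame (y i) := by
  induction A using Finset.induction_on with
  | empty => simp
  | insert q A hq ih =>
    intro b c y hb hc hy
    have hqm : q ∈ insert q A := Finset.mem_insert_self q A
    have hAm : ∀ {i}, i ∈ A → i ∈ insert q A := fun h => Finset.mem_insert_of_mem h
    set s : ℝ⟦X⟧ := (1 - c q q)⁻¹ with hs
    have hsmul : s * (1 - c q q) = 1 := by
      refine PowerSeries.inv_mul_cancel _ ?_
      rw [← coeff_zero_eq_constantCoeff_apply, map_sub, (hc q hqm q hqm).2]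
      simp
    have hst : Tame s := (hc q hqm q hqm).1.of_mul_one_sub_eq_one (hc q hqm q hqm).2 hsmul
    have hyq : y q = s * (b q + ∑ k ∈ A, c q k * y k) := by
      have h1 := hy q hqm
      rw [Finset.sum_insert hq] at h1
      linear_combination s * h1 - y q * hsmul
    have hyA : ∀ i ∈ A, Tame (y i) := by
      refine ih (fun i => b i + c i q * (s * b q)) (fun i k => c i k + c i q * (s * c q k)) y
        (fun i hi => (hb i (hAm hi)).add ((hc i (hAm hi) q hqm).1.mul (hst.mul (hb q hqm))))
        (fun i hi k hk => ⟨(hc i (hAm hi) k (hAm hk)).1.add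
          ((hc i (hAm hi) q hqm).1.mul (hst.mul (hc q hqm k (hAm hk)).1)), ?_⟩) fun i hi => ?_
      · rw [map_add, (hc i (hAm hi) k (hAm hk)).2, coeff_mul_range]
        simp only [zero_add, Finset.sum_range_one, (hc i (hAm hi) q hqm).2, zero_mul]
      · have h1 := hy i (hAm hi)
        rw [Finset.sum_insert hq] at h1
        have h2 : ∑ k ∈ A, (c i k + c i q * (s * c q k)) * y k
            = ∑ k ∈ A, c i k * y k + c i q * s * ∑ k ∈ A, c q k * y k := by
          rw [Finset.mul_sum, ← Finset.sum_add_distrib]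
          exact Finset.sum_congr rfl fun k _ => by ring
        rw [h2]
        linear_combination h1 + c i q * hyq
    intro i hi
    rcases Finset.mem_insert.1 hi with rfl | hi
    · rw [hyq]
      exact hst.mul ((hb i hqm).add
        (Tame.sum _ fun k hk => (hc i hqm k (hAm hk)).1.mul (hyA k hk)))
    · exact hyA i hi

lemma Regular.tendsto_div {u v : ℕ → ℝ} (hu : Regular u) (hv : Regular v) (hu0 : ∀ n, 0 < u n)
    (hv0 : ∀ n, 0 < v n) :
    (∃ y, Tendsto (fun n => u n / v n) atTop (𝓝 y)) ∨ Tendsto (fun n => u n / v n) atTop atTop := by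
  rcases hu.2 with hz | ⟨d, l, c, hl, hc, h1⟩
  · obtain ⟨n, hn⟩ := hz.exists
    exact absurd hn (hu0 n).ne'
  rcases hv.2 with hz | ⟨e, k, b, hk, hb, h2⟩
  · obtain ⟨n, hn⟩ := hz.exists
    exact absurd hn (hv0 n).ne'
  rcases binomGrowth_trichotomy d e hl hk with ⟨rfl, rfl⟩ | h | h
  · refine .inl ⟨c / b, (h1.div h2 hb.ne').congr fun n => ?_⟩
    have := binomGrowth_pos d hl n
    simp only [Pi.div_apply]
    field_simp
  · refine .inl ⟨c / b * 0, ((h1.div h2 hb.ne').mul h).congr fun n => ?_⟩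
    have := binomGrowth_pos d hl n
    have := binomGrowth_pos e hk n
    have := hv0 n
    simp only [Pi.div_apply]
    field_simp
  · right
    have h3 : Tendsto (fun n => v n / u n) atTop (𝓝 (b / c * 0)) := by
      refine ((h2.div h1 hc.ne').mul h).congr fun n => ?_
      have := binomGrowth_pos d hl n
      have := binomGrowth_pos e hk n
      have := hu0 n
      simp only [Pi.div_apply]
      field_simp
    rw [mul_zero] at h3
    have h4 : Tendsto (fun n => v n / u n) atTop (𝓝[>] 0) :=
      tendsto_nhdsWithin_iff.2 ⟨h3, Eventually.of_forall fun n => div_pos (hv0 n) (hu0 n)⟩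
    refine h4.inv_tendsto_nhdsGT_zero.congr fun n => ?_
    simp

/-- A series with positive coefficients and tame growth has finitely many opposite series. -/
theorem finite_oppositeSeries_of_tame {a : ℕ → ℝ} (ha : ∀ n, 0 < a n)
    (h : Tame (PowerSeries.mk a)) : {ω : ℕ → ℝ | OppositeSeries a ω}.Finite := by
  obtain ⟨p, hp, h⟩ := h
  simp only [TameAt, coeff_mk] at h
  have hlim : ∀ r k, (∃ y, Tendsto (fun n => a (n - k) / a n) (atTop ⊓ 𝓟 {n | n % p = r}) (𝓝 y)) ∨
      Tendsto (fun n => a (n - k) / a n) (atTop ⊓ 𝓟 {n | n % p = r}) atTop := by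
    intro r k
    have hk : k ≤ p * k := Nat.le_mul_of_pos_left k hp
    have ht : Tendsto (fun n => n / p - k) (atTop ⊓ 𝓟 {n | n % p = r}) atTop :=
      ((tendsto_sub_atTop_nat k).comp (Nat.tendsto_div_const_atTop hp.ne')).mono_left inf_le_left
    have heq : (fun m => a (p * m + (r + p * k - k)) / a (p * m + (r + p * k))) ∘
        (fun n => n / p - k) =ᶠ[atTop ⊓ 𝓟 {n | n % p = r}] fun n => a (n - k) / a n := by
      have h1 : ∀ᶠ n in atTop ⊓ 𝓟 {n | n % p = r}, n % p = r :=
        mem_inf_of_right (mem_principal_self _)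
      filter_upwards [h1, mem_inf_of_left (eventually_ge_atTop (p * k))] with n hn hnk
      have h2 : k ≤ n / p := (Nat.le_div_iff_mul_le hp).2 (by rwa [mul_comm])
      have h3 : p * (n / p - k) + (r + p * k) = n := by
        conv_rhs => rw [← Nat.div_add_mod n p, hn]
        rw [Nat.mul_sub]
        have := Nat.mul_le_mul_left p h2
        omega
      have h4 : p * (n / p - k) + (r + p * k - k) = n - k := by omega
      simp only [Function.comp, h3, h4]
    rcases (h (r + p * k - k)).tendsto_div (h (r + p * k)) (fun n => ha _) (fun n => ha _) with
      ⟨y, hy⟩ | hy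
    · exact .inl ⟨y, (hy.comp ht).congr' heq⟩
    · exact .inr ((hy.comp ht).congr' heq)
  have hcover : {ω : ℕ → ℝ | OppositeSeries a ω} ⊆ ⋃ r ∈ Set.Iio p, {ω | ∃ φ : ℕ → ℕ, StrictMono φ ∧
      (∃ᶠ j in atTop, φ j % p = r) ∧
      ∀ k : ℕ, Tendsto (fun j => a (φ j - k) / a (φ j)) atTop (𝓝 (ω k))} := by
    rintro ω ⟨φ, hφ, hω⟩
    have hfreq : ∃ r ∈ Finset.range p, ∃ᶠ j in atTop, φ j % p = r := by
      by_contra! hcon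
      obtain ⟨j, hj⟩ := ((eventually_all_finset _).2 hcon).exists
      exact hj _ (Finset.mem_range.2 (Nat.mod_lt (φ j) hp)) rfl
    obtain ⟨r, hr, hr'⟩ := hfreq
    exact Set.mem_biUnion (Finset.mem_range.1 hr) ⟨φ, hφ, hr', hω⟩
  refine Set.Finite.subset ((Set.finite_Iio p).biUnion fun r _ => Set.Subsingleton.finite ?_) hcover
  rintro ω ⟨φ, hφ, hφr, hω⟩ ω' ⟨ψ, hψ, hψr, hω'⟩
  funext k
  have hmap : ∀ φ : ℕ → ℕ, StrictMono φ →
      Tendsto φ (atTop ⊓ 𝓟 {j | φ j % p = r}) (atTop ⊓ 𝓟 {n | n % p = r}) := by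
    intro φ hφ
    exact hφ.tendsto_atTop.inf (tendsto_principal_principal.2 fun j hj => hj)
  have hne : ∀ φ : ℕ → ℕ, (∃ᶠ j in atTop, φ j % p = r) → (atTop ⊓ 𝓟 {j | φ j % p = r}).NeBot :=
    fun φ h => frequently_mem_iff_neBot.1 h
  have := hne φ hφr
  have := hne ψ hψr
  rcases hlim r k with ⟨y, hy⟩ | hy
  · rw [tendsto_nhds_unique ((hω k).mono_left inf_le_left) (hy.comp (hmap φ hφ)),
      tendsto_nhds_unique ((hω' k).mono_left inf_le_left) (hy.comp (hmap ψ hψ))]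
  · exact absurd ((hω k).mono_left inf_le_left)
      (not_tendsto_nhds_of_tendsto_atTop (hy.comp (hmap φ hφ)) _)

end Tame

section WordLength

variable {G : Type*} [Group G]

/-- The properties of the word length of a hyperbolic group on which the growth estimate rests:
the last one says that `g` is `N`-close to any geodesic from `1` to `g * h` as soon as the product
`g * h` has small cancellation. -/
structure IsHyperbolicLength (S : Finset G) (N : ℕ) (l : G → ℕ) : Prop where
  one : l 1 = 0
  eq_one : ∀ g, l g = 0 → g = 1
  mul_le : ∀ g h, l (g * h) ≤ l g + l h
  inv : ∀ g, l g⁻¹ = l g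
  le_one : ∀ s ∈ S, l s ≤ 1
  exists_pred : ∀ g n, l g = n + 1 → ∃ s ∈ S, l (g * s⁻¹) = n
  exists_mid : ∀ g h, l g + l h ≤ l (g * h) + 5 →
    ∃ z, l z ≤ N ∧ l (g * h) = l (g * z) + l (z⁻¹ * h)

lemma cayleyGraph_adj {S : Finset G} (hsym : ∀ s ∈ S, s⁻¹ ∈ S) (hone : (1 : G) ∉ S) {g h : G} :
    (cayleyGraph (S : Set G)).Adj g h ↔ g⁻¹ * h ∈ S := by
  simp only [cayleyGraph, SimpleGraph.fromRel_adj, Finset.mem_coe]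
  constructor
  · rintro ⟨-, h1 | h1⟩
    · exact h1
    · simpa using hsym _ h1
  · refine fun h1 => ⟨?_, .inl h1⟩
    rintro rfl
    exact hone (by simpa using h1)

/-- Left translation as an endomorphism of the Cayley graph. -/
def cayleyTranslation (S : Set G) (k : G) : cayleyGraph S →g cayleyGraph S where
  toFun g := k * g
  map_rel' := by
    intro a b h
    simpa [cayleyGraph, SimpleGraph.fromRel_adj, mul_assoc] using h

lemma cayleyGraph_connected {S : Finset G} (hsym : ∀ s ∈ S, s⁻¹ ∈ S) (hone : (1 : G) ∉ S)
    (hgen : Subgroup.closure (S : Set G) = ⊤) : (cayleyGraph (S : Set G)).Connected := by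
  have key : ∀ g : G, (cayleyGraph (S : Set G)).Reachable 1 g := by
    intro g
    have hg : g ∈ Subgroup.closure (S : Set G) := hgen ▸ Subgroup.mem_top g
    induction hg using Subgroup.closure_induction with
    | mem x hx => exact ((cayleyGraph_adj hsym hone).2 (by simpa using hx)).reachable
    | one => exact Reachable.refl 1
    | mul x y _ _ hx hy =>
      have h1 := hy.map (cayleyTranslation (S : Set G) x)
      simp only [cayleyTranslation, RelHom.coeFn_mk, mul_one] at h1
      exact hx.trans h1
    | inv x _ hx =>
      have h1 := hx.map (cayleyTranslation (S : Set G) x⁻¹)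
      simp only [cayleyTranslation, RelHom.coeFn_mk, mul_one, inv_mul_cancel] at h1
      exact h1.symm
  exact ⟨fun u v => (key u).symm.trans (key v)⟩

lemma cayleyGraph_dist_mul_left {S : Set G} (hc : (cayleyGraph S).Connected) (k g h : G) :
    (cayleyGraph S).dist (k * g) (k * h) = (cayleyGraph S).dist g h := by
  have hle : ∀ k g h : G, (cayleyGraph S).dist (k * g) (k * h) ≤ (cayleyGraph S).dist g h := by
    intro k g h
    obtain ⟨p, hp⟩ := hc.exists_walk_length_eq_dist g h
    rw [← hp, ← Walk.length_map (cayleyTranslation S k) p]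
    exact dist_le _
  refine le_antisymm (hle k g h) ?_
  simpa using hle k⁻¹ (k * g) (k * h)

lemma cayleyGraph_dist {S : Set G} (hc : (cayleyGraph S).Connected) (g h : G) :
    (cayleyGraph S).dist g h = (cayleyGraph S).dist 1 (g⁻¹ * h) := by
  simpa using (cayleyGraph_dist_mul_left hc g⁻¹ g h).symm

lemma IsGeodesic.dist_add_dist {V : Type*} {C : SimpleGraph V} (hc : C.Connected) {a b v : V}
    {p : C.Walk a b} (hp : IsGeodesic C p) (hv : v ∈ p.support) :
    C.dist a v + C.dist v b = C.dist a b := by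
  obtain ⟨q, r, rfl⟩ := p.mem_support_iff_exists_append.1 hv
  refine le_antisymm ?_ hc.dist_triangle
  rw [← hp, Walk.length_append]
  exact add_le_add (dist_le q) (dist_le r)

lemma exists_isGeodesic {V : Type*} {C : SimpleGraph V} (hc : C.Connected) (a b : V) :
    ∃ p : C.Walk a b, IsGeodesic C p := hc.exists_walk_length_eq_dist a b

/-- On one side of a thin triangle, some vertex is close to one of the other sides while itself or
the next vertex is close to the other one. -/
lemma exists_near_both_sides {V : Type*} {C : SimpleGraph V} (hc : C.Connected) {δ : ℝ}
    (hδ : 0 ≤ δ) (hhyp : IsDeltaHyperbolic C δ) {a b c : V} {p : C.Walk a b} {q : C.Walk b c}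
    {r : C.Walk a c} (hp : IsGeodesic C p) (hq : IsGeodesic C q) (hr : IsGeodesic C r) :
    ∃ v ∈ r.support, ∃ x ∈ p.support, ∃ y ∈ q.support,
      (C.dist v x : ℝ) ≤ δ ∧ (C.dist v y : ℝ) ≤ δ + 1 := by
  classical
  have hthin := (hhyp p q r hp hq hr).2.2
  set P : ℕ → Prop := fun i => ∃ x ∈ p.support, (C.dist (r.getVert i) x : ℝ) ≤ δ with hP
  have hP0 : P 0 := ⟨a, p.start_mem_support, by simpa using hδ⟩
  obtain ⟨x, hx, hxd⟩ : P (Nat.findGreatest P r.length) :=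
    Nat.findGreatest_spec (Nat.zero_le _) hP0
  have hle : Nat.findGreatest P r.length ≤ r.length := Nat.findGreatest_le _
  refine ⟨_, r.getVert_mem_support (Nat.findGreatest P r.length), x, hx, ?_⟩
  rcases hle.eq_or_lt with heq | hlt
  · refine ⟨c, q.end_mem_support, hxd, ?_⟩
    rw [heq, Walk.getVert_length, dist_self, Nat.cast_zero]
    linarith
  · have hnot : ¬ P (Nat.findGreatest P r.length + 1) :=
      Nat.findGreatest_is_greatest (Nat.lt_succ_self _) hlt
    obtain ⟨w, hw | hw, hwd⟩ := hthin _ (r.getVert_mem_support (Nat.findGreatest P r.length + 1))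
    · exact absurd ⟨w, hw, hwd⟩ hnot
    · refine ⟨w, hw, hxd, ?_⟩
      have h1 := dist_eq_one_iff_adj.2 (r.adj_getVert_succ hlt)
      have h2 := hc.dist_triangle (u := r.getVert (Nat.findGreatest P r.length))
        (v := r.getVert (Nat.findGreatest P r.length + 1)) (w := w)
      rw [h1] at h2
      have h3 : (C.dist (r.getVert (Nat.findGreatest P r.length)) w : ℝ)
          ≤ 1 + C.dist (r.getVert (Nat.findGreatest P r.length + 1)) w := by exact_mod_cast h2
      linarith

lemma exists_isHyperbolicLength {S : Finset G} (hsym : ∀ s ∈ S, s⁻¹ ∈ S) (hone : (1 : G) ∉ S)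
    (hgen : Subgroup.closure (S : Set G) = ⊤) {δ : ℝ} (hδ : 0 ≤ δ)
    (hhyp : IsDeltaHyperbolic (cayleyGraph (S : Set G)) δ) :
    ∃ N, IsHyperbolicLength S N fun g => (cayleyGraph (S : Set G)).dist 1 g := by
  have hc := cayleyGraph_connected hsym hone hgen
  refine ⟨⌈3 * δ + 6⌉₊, dist_self, fun g hg => ((hc.dist_eq_zero_iff).1 hg).symm, fun g h => ?_,
    fun g => ?_, fun s hs => ?_, fun g n hg => ?_, fun g h hgh => ?_⟩
  · have h1 := cayleyGraph_dist hc g (g * h)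
    rw [inv_mul_cancel_left] at h1
    rw [← h1]
    exact hc.dist_triangle
  · rw [dist_comm, cayleyGraph_dist hc g⁻¹ 1]
    simp
  · exact (dist_eq_one_iff_adj.2 ((cayleyGraph_adj hsym hone).2 (by simpa using hs))).le
  · obtain ⟨p, hp⟩ := exists_isGeodesic hc 1 g
    have hlen : p.length = n + 1 := hp.trans hg
    have hadj := p.adj_getVert_succ (i := n) (by omega)
    have hend : p.getVert (n + 1) = g := by rw [← hlen, Walk.getVert_length]
    rw [hend] at hadj
    have h1 := hp.dist_add_dist hc (p.getVert_mem_support n)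
    rw [dist_eq_one_iff_adj.2 hadj, hg] at h1
    refine ⟨(p.getVert n)⁻¹ * g, (cayleyGraph_adj hsym hone).1 hadj, ?_⟩
    simp only [mul_inv_rev, inv_inv, mul_inv_cancel_left]
    omega
  · obtain ⟨p, hp⟩ := exists_isGeodesic hc 1 g
    obtain ⟨q, hq⟩ := exists_isGeodesic hc g (g * h)
    obtain ⟨r, hr⟩ := exists_isGeodesic hc 1 (g * h)
    obtain ⟨v, hv, x, hx, y, hy, hvx, hvy⟩ := exists_near_both_sides hc hδ hhyp hp hq hr
    have h1 := hp.dist_add_dist hc hx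
    have h2 := hq.dist_add_dist hc hy
    have h3 := hr.dist_add_dist hc hv
    have h4 : (cayleyGraph (S : Set G)).dist g (g * h) = (cayleyGraph (S : Set G)).dist 1 h := by
      rw [cayleyGraph_dist hc, inv_mul_cancel_left]
    have h5 := hc.dist_triangle (u := 1) (v := x) (w := v)
    have h6 := hc.dist_triangle (u := v) (v := y) (w := g * h)
    have h7 := hc.dist_triangle (u := g) (v := x) (w := v)
    rw [dist_comm (u := x) (v := v)] at h5 h7
    rw [dist_comm (u := g) (v := x)] at h7
    refine ⟨g⁻¹ * v, ?_, ?_⟩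
    · rw [← cayleyGraph_dist hc]
      have h8 : ((cayleyGraph (S : Set G)).dist g v : ℝ) ≤ 3 * δ + 6 := by
        rify at *
        linarith [Nat.cast_nonneg (α := ℝ) ((cayleyGraph (S : Set G)).dist g y)]
      exact_mod_cast h8.trans (Nat.le_ceil _)
    · rw [mul_inv_cancel_left, ← h3, cayleyGraph_dist hc v]
      simp [mul_assoc]

end WordLength

section HyperbolicGrowth

open PowerSeries

variable {G : Type*} [Group G] {S : Finset G} {N : ℕ} {l : G → ℕ}

namespace IsHyperbolicLength

lemma mul_gen_le (H : IsHyperbolicLength S N l) (g : G) {s : G} (hs : s ∈ S) :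
    l (g * s) ≤ l g + 1 :=
  (H.mul_le g s).trans (Nat.add_le_add_left (H.le_one s hs) _)

lemma le_mul_add (H : IsHyperbolicLength S N l) (g h : G) : l g ≤ l (g * h) + l h := by
  simpa [H.inv] using H.mul_le (g * h) h⁻¹

lemma finite_le (H : IsHyperbolicLength S N l) (n : ℕ) : {g | l g ≤ n}.Finite := by
  induction n with
  | zero => exact (Set.finite_singleton 1).subset fun g hg => H.eq_one g (Nat.le_zero.1 hg)
  | succ n ih =>
    refine (ih.union (Set.Finite.image2 (· * ·) ih S.finite_toSet)).subset fun g hg => ?_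
    rcases Nat.le_or_eq_of_le_succ hg with h | h
    · exact .inl h
    · obtain ⟨s, hs, h1⟩ := H.exists_pred g n h
      exact .inr ⟨g * s⁻¹, h1.le, s, hs, inv_mul_cancel_right g s⟩

lemma exists_eq [Infinite G] (H : IsHyperbolicLength S N l) (n : ℕ) : ∃ g, l g = n := by
  by_contra! hn
  have h1 : ∀ m g, l g ≠ n + m := by
    intro m
    induction m with
    | zero => exact hn
    | succ m ih =>
      intro g hg
      obtain ⟨s, -, h⟩ := H.exists_pred g (n + m) hg
      exact ih _ h
  refine Set.infinite_univ ((H.finite_le n).subset fun g _ => ?_)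
  by_contra hg
  have hg : ¬ l g ≤ n := hg
  exact h1 (l g - n) g (by omega)

end IsHyperbolicLength

/-- The change of length under right multiplication of `g` by `h`, truncated from below at
`l h - 3`. -/
def lengthProfile (l : G → ℕ) (g h : G) : ℤ := max ((l (g * h) : ℤ) - l g) (l h - 3)

namespace IsHyperbolicLength

lemma sub_le_of_agree (H : IsHyperbolicLength S N l) {g g' : G}
    (hgg : ∀ z, l z ≤ N → (l (g * z) : ℤ) - l g = l (g' * z) - l g') (n : ℕ) :
    ∀ h, l h = n → (l (g' * h) : ℤ) - l g' ≤ lengthProfile l g h := by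
  induction n with
  | zero =>
    intro h hh
    rw [H.eq_one h hh]
    simp [lengthProfile]
  | succ n ih =>
    intro h hh
    by_cases hc : l g + l h ≤ l (g * h) + 5
    · obtain ⟨z, hz, hmid⟩ := H.exists_mid g h hc
      have h1 := hgg z hz
      have h2 := H.mul_le (g' * z) (z⁻¹ * h)
      rw [mul_assoc, mul_inv_cancel_left] at h2
      refine le_trans ?_ (le_max_left _ _)
      omega
    · obtain ⟨s, hs, hk⟩ := H.exists_pred h n hh
      have h1 := ih _ hk
      have h2 := H.mul_gen_le (g' * (h * s⁻¹)) hs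
      have h3 := H.le_mul_add (g * (h * s⁻¹)) s
      have h4 := H.le_one s hs
      rw [mul_assoc, inv_mul_cancel_right] at h2 h3
      refine le_trans ?_ (le_max_right _ _)
      rw [lengthProfile, le_max_iff] at h1
      omega

lemma lengthProfile_eq_of_agree (H : IsHyperbolicLength S N l) {g g' : G}
    (hgg : ∀ z, l z ≤ N → (l (g * z) : ℤ) - l g = l (g' * z) - l g') :
    lengthProfile l g = lengthProfile l g' := by
  funext h
  refine le_antisymm (max_le ?_ (le_max_right _ _)) (max_le ?_ (le_max_right _ _))
  · exact H.sub_le_of_agree (fun z hz => (hgg z hz).symm) _ h rfl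
  · exact H.sub_le_of_agree hgg _ h rfl

lemma finite_range_lengthProfile (H : IsHyperbolicLength S N l) :
    (Set.range (lengthProfile l)).Finite := by
  have : Finite {z // l z ≤ N} := (H.finite_le N).to_subtype
  set F : G → {z // l z ≤ N} → ℤ := fun g z => (l (g * z) : ℤ) - l g with hF
  have hfin : (Set.range F).Finite := by
    refine (Set.Finite.pi' fun _ => Set.finite_Icc (-(N : ℤ)) N).subset ?_
    rintro _ ⟨g, rfl⟩ ⟨z, hz⟩
    have h1 := H.mul_le g z
    have h2 := H.le_mul_add g z
    simp only [hF, Set.mem_Icc]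
    omega
  obtain ⟨φ, hφ⟩ : ∃ φ, lengthProfile l = φ ∘ F :=
    (Function.factorsThrough_iff _).1 fun g g' hgg =>
      H.lengthProfile_eq_of_agree fun z hz => congrFun hgg ⟨z, hz⟩
  rw [hφ, Set.range_comp]
  exact hfin.image φ

lemma mul_gen_eq_of_profile_eq (H : IsHyperbolicLength S N l) {g g' s : G} (hs : s ∈ S)
    (hgg : lengthProfile l g = lengthProfile l g') (hup : l (g * s) = l g + 1) :
    l (g' * s) = l g' + 1 := by
  have h1 := congrFun hgg s
  have h2 := H.le_one s hs
  simp only [lengthProfile] at h1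
  omega

lemma profile_mul_gen (H : IsHyperbolicLength S N l) {g s : G} (hs : s ∈ S)
    (hup : l (g * s) = l g + 1) (h : G) :
    lengthProfile l (g * s) h = max (lengthProfile l g (s * h) - 1) (l h - 3) := by
  have h1 := H.mul_le s h
  have h2 := H.le_one s hs
  simp only [lengthProfile, mul_assoc]
  omega

lemma profile_mul_gen_eq (H : IsHyperbolicLength S N l) {g g' s : G} (hs : s ∈ S)
    (hgg : lengthProfile l g = lengthProfile l g') (hup : l (g * s) = l g + 1) :
    lengthProfile l (g * s) = lengthProfile l (g' * s) := by
  funext h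
  rw [H.profile_mul_gen hs hup, H.profile_mul_gen hs (H.mul_gen_eq_of_profile_eq hs hgg hup), hgg]

end IsHyperbolicLength

/-- The number of neighbours of `x` that are closer to `1`. -/
def predCount (S : Finset G) (l : G → ℕ) (x : G) : ℕ :=
  (S.filter fun s => l (x * s⁻¹) + 1 = l x).card

/-- The number of elements of length `l g + n` lying on a geodesic from `1` through `g`, where an
element counts with the probability that a random backward geodesic passes through `g`. -/
noncomputable def coneGrowth (S : Finset G) (l : G → ℕ) : ℕ → G → ℝ
  | 0, _ => 1
  | n + 1, g => ∑ s ∈ S.filter fun s => l (g * s) = l g + 1,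
      (predCount S l (g * s) : ℝ)⁻¹ * coneGrowth S l n (g * s)

namespace IsHyperbolicLength

lemma predCount_eq (H : IsHyperbolicLength S N l) {g g' s : G} (hs : s ∈ S)
    (hgg : lengthProfile l g = lengthProfile l g') (hup : l (g * s) = l g + 1) :
    predCount S l (g * s) = predCount S l (g' * s) := by
  have hup' := H.mul_gen_eq_of_profile_eq hs hgg hup
  unfold predCount
  congr 1
  refine Finset.filter_congr fun s' hs' => ?_
  have h1 := congrFun hgg (s * s'⁻¹)
  have h2 := H.mul_le s s'⁻¹
  have h3 := H.le_one s hs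
  have h4 := H.le_one s' hs'
  rw [H.inv] at h2
  simp only [lengthProfile] at h1
  rw [mul_assoc, mul_assoc]
  omega

lemma coneGrowth_eq (H : IsHyperbolicLength S N l) (n : ℕ) : ∀ {g g' : G},
    lengthProfile l g = lengthProfile l g' → coneGrowth S l n g = coneGrowth S l n g' := by
  induction n with
  | zero => exact fun _ => rfl
  | succ n ih =>
    intro g g' hgg
    simp only [coneGrowth]
    refine Finset.sum_congr (Finset.filter_congr fun s hs => ?_) fun s hs => ?_
    · exact ⟨H.mul_gen_eq_of_profile_eq hs hgg, H.mul_gen_eq_of_profile_eq hs hgg.symm⟩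
    · obtain ⟨hs, hup'⟩ := Finset.mem_filter.1 hs
      have hup := H.mul_gen_eq_of_profile_eq hs hgg.symm hup'
      rw [H.predCount_eq hs hgg hup, ih (H.profile_mul_gen_eq hs hgg hup)]

lemma predCount_pos (H : IsHyperbolicLength S N l) {x : G} {n : ℕ} (hx : l x = n + 1) :
    0 < predCount S l x := by
  obtain ⟨s, hs, h⟩ := H.exists_pred x n hx
  exact Finset.card_pos.2 ⟨s, Finset.mem_filter.2 ⟨hs, by omega⟩⟩

lemma sum_coneGrowth (H : IsHyperbolicLength S N l) (B : ℕ → Finset G)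
    (hB : ∀ n x, x ∈ B n ↔ l x = n) (m : ℕ) :
    ∀ n, ∑ x ∈ B n, coneGrowth S l m x = (B (n + m)).card := by
  induction m with
  | zero => simp [coneGrowth]
  | succ m ih =>
    intro n
    calc ∑ x ∈ B n, coneGrowth S l (m + 1) x
        = ∑ y ∈ B (n + 1), ∑ _s ∈ S.filter fun s => l (y * s⁻¹) + 1 = l y,
            (predCount S l y : ℝ)⁻¹ * coneGrowth S l m y := by
          simp only [coneGrowth]
          rw [Finset.sum_sigma', Finset.sum_sigma']
          refine Finset.sum_bij' (fun a _ => ⟨a.1 * a.2, a.2⟩) (fun a _ => ⟨a.1 * a.2⁻¹, a.2⟩)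
            ?_ ?_ ?_ ?_ ?_
          · rintro ⟨x, s⟩ h
            simp only [Finset.mem_sigma, Finset.mem_filter, hB, mul_inv_cancel_right] at h ⊢
            exact ⟨by omega, h.2.1, by omega⟩
          · rintro ⟨x, s⟩ h
            simp only [Finset.mem_sigma, Finset.mem_filter, hB, inv_mul_cancel_right] at h ⊢
            exact ⟨by omega, h.2.1, by omega⟩
          · rintro ⟨x, s⟩ h
            simp
          · rintro ⟨x, s⟩ h
            simp
          · rintro ⟨x, s⟩ h
            rfl
      _ = ∑ y ∈ B (n + 1), coneGrowth S l m y := by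
          refine Finset.sum_congr rfl fun y hy => ?_
          have hpos := H.predCount_pos ((hB _ _).1 hy)
          rw [Finset.sum_const, nsmul_eq_mul, ← mul_assoc]
          have : ((predCount S l y : ℕ) : ℝ) ≠ 0 := by exact_mod_cast hpos.ne'
          rw [show (S.filter fun s => l (y * s⁻¹) + 1 = l y).card = predCount S l y from rfl,
            mul_inv_cancel₀ this, one_mul]
      _ = (B (n + (m + 1))).card := by rw [ih, add_assoc, add_comm 1 m]

lemma tame_coneGrowth (H : IsHyperbolicLength S N l) :
    Tame (PowerSeries.mk fun n => coneGrowth S l n 1) := by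
  classical
  set rep : G → G := fun g => Function.invFun (lengthProfile l) (lengthProfile l g) with hrep
  have hprof : ∀ g, lengthProfile l (rep g) = lengthProfile l g :=
    fun g => Function.invFun_eq ⟨g, rfl⟩
  have hfin : (Set.range rep).Finite := by
    rw [hrep, ← Function.comp_def, Set.range_comp]
    exact H.finite_range_lengthProfile.image _
  have hmem : ∀ g, rep g ∈ hfin.toFinset := fun g => hfin.mem_toFinset.2 ⟨g, rfl⟩
  have hone : (fun n => coneGrowth S l n 1) = fun n => coneGrowth S l n (rep 1) :=
    funext fun n => H.coneGrowth_eq n (hprof 1).symm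
  rw [hone]
  set c : G → G → ℝ := fun g k => ∑ s ∈ (S.filter fun s => l (g * s) = l g + 1).filter
    fun s => rep (g * s) = k, (predCount S l (g * s) : ℝ)⁻¹ with hc
  refine tame_of_linear_system hfin.toFinset (fun _ => 1) (fun g k => C (c g k) * X)
    (fun g => PowerSeries.mk fun n => coneGrowth S l n g) (fun _ _ => Tame.one)
    (fun g _ k _ => ⟨Tame.C_mul_X (Finset.sum_nonneg fun s _ => by positivity), by simp⟩)
    (fun g _ => ?_) (rep 1) (hmem 1)
  ext n
  rcases n with _ | n
  · simp [coneGrowth, mul_assoc]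
  · have h1 : ∀ k, coeff (n + 1) (C (c g k) * X * PowerSeries.mk fun n => coneGrowth S l n k)
        = c g k * coneGrowth S l n k := by
      intro k
      rw [mul_assoc, coeff_C_mul, coeff_succ_X_mul, coeff_mk]
    simp only [map_add, map_sum, h1, coeff_mk, coneGrowth]
    rw [coeff_one, if_neg (Nat.succ_ne_zero n), zero_add,
      ← Finset.sum_fiberwise_of_maps_to (t := hfin.toFinset) (g := fun s => rep (g * s))
        fun s _ => hmem _]
    refine Finset.sum_congr rfl fun k _ => ?_
    rw [hc, Finset.sum_mul]
    refine Finset.sum_congr rfl fun s hs => ?_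
    rw [← (Finset.mem_filter.1 hs).2, H.coneGrowth_eq n (hprof (g * s))]

/-- The spherical growth series of a group with a hyperbolic length has finitely many opposite
series. -/
theorem finite_oppositeSeries [Infinite G] (H : IsHyperbolicLength S N l) :
    {ω : ℕ → ℝ | OppositeSeries (fun n => (Nat.card {g : G | l g = n} : ℝ)) ω}.Finite := by
  have hfin : ∀ n, {g | l g = n}.Finite := fun n => (H.finite_le n).subset fun g hg => le_of_eq hg
  have hcard : ∀ n, Nat.card {g | l g = n} = (hfin n).toFinset.card := fun n =>
    Nat.card_eq_card_finite_toFinset (hfin n)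
  have hgrowth : (fun n => (Nat.card {g : G | l g = n} : ℝ)) = fun n => coneGrowth S l n 1 := by
    funext n
    have h0 : (hfin 0).toFinset = {1} := by
      ext g
      simp only [Set.Finite.mem_toFinset, Set.mem_ofPred_eq, Finset.mem_singleton]
      exact ⟨H.eq_one g, fun h => h ▸ H.one⟩
    have h1 := H.sum_coneGrowth (fun n => (hfin n).toFinset) (by simp) n 0
    rw [h0, Finset.sum_singleton, zero_add] at h1
    rw [h1, hcard]
  refine finite_oppositeSeries_of_tame (fun n => ?_) ?_
  · obtain ⟨g, hg⟩ := H.exists_eq n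
    rw [hcard, Nat.cast_pos, Finset.card_pos]
    exact ⟨g, (hfin n).mem_toFinset.2 hg⟩
  · rw [hgrowth]
    exact H.tame_coneGrowth

end IsHyperbolicLength

end HyperbolicGrowth

/-- for an infinite word hyperbolic group `G` with finite symmetric
generating set `S`, the set of opposite series of the growth series
`P_{G,S}(t) = Σ aₙ tⁿ` (with `aₙ` the number of elements of word length `n`)
is finite. -/
theorem opposite_series_finite_hyperbolic_group {G : Type*} [Group G] [Infinite G]
    (S : Finset G) (hsym : ∀ s ∈ S, s⁻¹ ∈ S) (hone : (1:G) ∉ S)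
    (hgen : Subgroup.closure (S : Set G) = ⊤)
    (δ : ℝ) (hδ : 0 ≤ δ) (hhyp : IsDeltaHyperbolic (cayleyGraph (S : Set G)) δ) :
    {ω : ℕ → ℝ | OppositeSeries
        (fun n : ℕ =>
          (Nat.card {g : G | (cayleyGraph (S : Set G)).dist 1 g = n} : ℝ)) ω}.Finite := by
  obtain ⟨N, H⟩ := exists_isHyperbolicLength hsym hone hgen hδ hhyp
  exact H.finite_oppositeSeries

end CF
end

section
/- Let G be the (2,3,7) triangle group with presentation G = ⟨a, b | a², b³, (ab)⁷⟩ and let ℓ(g) denote the word length of g with respect to the generating set S = {a, b, b⁻¹}. Then the set of dead-end elements of G has positive lower density: liminf_{n→∞} ( #{g ∈ G : ℓ(g) ≤ n and g is a dead end} / #{g ∈ G : ℓ(g) ≤ n} ) > 0. -/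
open SimpleGraph Filter

namespace CF

/-- The relators of the (2,3,7) triangle group `⟨a, b | a², b³, (ab)⁷⟩`, with
`a = FreeGroup.of true` and `b = FreeGroup.of false`. -/
def triRels : Set (FreeGroup Bool) :=
  {FreeGroup.of true ^ 2, FreeGroup.of false ^ 3,
   (FreeGroup.of true * FreeGroup.of false) ^ 7}

/-- The (2,3,7) triangle group. -/
abbrev Tri : Type := PresentedGroup triRels

/-- The generator `a` of the triangle group. -/
def triA : Tri := PresentedGroup.of true

/-- The generator `b` of the triangle group. -/
def triB : Tri := PresentedGroup.of false

/-- The generating set `S = {a, b, b⁻¹}`. -/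
def triGen : Set Tri := {triA, triB, triB⁻¹}

/-- The Cayley graph of the triangle group with respect to `S = {a, b, b⁻¹}`
(note `a = a⁻¹` in the group, so `S` is symmetric and the word metric is the
graph metric). -/
def triGraph : SimpleGraph Tri := SimpleGraph.fromRel (fun g h => g⁻¹ * h ∈ triGen)

/-- Word length with respect to `S = {a, b, b⁻¹}`. -/
noncomputable def wlen (g : Tri) : ℕ := triGraph.dist 1 g

/-- `g` is a dead end: there is no `z ≠ g` with `ℓ(z) = ℓ(g) + d(g,z)`. -/
def IsDeadEnd (g : Tri) : Prop :=
  ∀ z : Tri, wlen z = wlen g + triGraph.dist g z → z = g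

open scoped Pointwise

lemma triA_mul_triA : triA * triA = 1 := by
  have h : (PresentedGroup.mk triRels (FreeGroup.of true ^ 2)) = 1 :=
    PresentedGroup.one_of_mem (by simp [triRels])
  rw [← pow_two]
  exact (map_pow _ _ _).symm.trans h

lemma triB_pow_three : triB ^ 3 = 1 := by
  have h : (PresentedGroup.mk triRels (FreeGroup.of false ^ 3)) = 1 :=
    PresentedGroup.one_of_mem (by simp [triRels])
  exact (map_pow _ _ _).symm.trans h

lemma triA_mul_triB_pow_seven : (triA * triB) ^ 7 = 1 := by
  have h : (PresentedGroup.mk triRels ((FreeGroup.of true * FreeGroup.of false) ^ 7)) = 1 :=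
    PresentedGroup.one_of_mem (by simp [triRels])
  rw [map_pow, map_mul] at h
  exact h

lemma triB_mul_triB : triB * triB = triB⁻¹ := by
  rw [eq_inv_iff_mul_eq_one, ← triB_pow_three, pow_succ, pow_two]

lemma triB_inv_mul_triB_inv : triB⁻¹ * triB⁻¹ = triB := by
  rw [← mul_inv_rev, triB_mul_triB, inv_inv]

lemma triA_inv : triA⁻¹ = triA := inv_eq_of_mul_eq_one_left triA_mul_triA

lemma inv_mem_triGen {s : Tri} (hs : s ∈ triGen) : s⁻¹ ∈ triGen := by
  rcases hs with rfl | rfl | rfl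
  · rw [triA_inv]; exact Or.inl rfl
  · exact Or.inr (Or.inr rfl)
  · rw [inv_inv]; exact Or.inr (Or.inl rfl)

lemma triGraph_adj {g h : Tri} : triGraph.Adj g h ↔ g ≠ h ∧ g⁻¹ * h ∈ triGen := by
  rw [triGraph, SimpleGraph.fromRel_adj]
  refine and_congr_right fun _ => or_iff_left_of_imp fun hs => ?_
  simpa using inv_mem_triGen hs

lemma eq_or_adj_mul {g s : Tri} (hs : s ∈ triGen) : g = g * s ∨ triGraph.Adj g (g * s) := by
  by_cases h : g = g * s
  · exact Or.inl h
  · exact Or.inr (triGraph_adj.2 ⟨h, by simpa using hs⟩)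

lemma reachable_mul_of_mem_triGen {g s : Tri} (hs : s ∈ triGen) :
    triGraph.Reachable g (g * s) := by
  rcases eq_or_adj_mul (g := g) hs with h | h
  · rw [← h]
  · exact h.reachable

lemma of_mem_triGen (x : Bool) : (PresentedGroup.of x : Tri) ∈ triGen := by
  cases x
  · exact Or.inr (Or.inl rfl)
  · exact Or.inl rfl

lemma triGraph_reachable_mul (h : Tri) : ∀ g : Tri, triGraph.Reachable g (g * h) := by
  induction h using PresentedGroup.induction_on with
  | _ z =>
    induction z using FreeGroup.induction_on with
    | C1 => intro g; simp
    | of x => exact fun g => reachable_mul_of_mem_triGen (of_mem_triGen x)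
    | inv_of x _ =>
      intro g
      rw [map_inv]
      exact reachable_mul_of_mem_triGen (inv_mem_triGen (of_mem_triGen x))
    | mul x y hx hy =>
      intro g
      rw [map_mul, ← mul_assoc]
      exact (hx g).trans (hy _)

lemma triGraph_connected : triGraph.Connected :=
  (SimpleGraph.connected_iff _).2
    ⟨fun g h => by simpa using triGraph_reachable_mul (g⁻¹ * h) g, ⟨1⟩⟩

/-- Every vertex other than `h` has a neighbour that is one step closer to `h`. -/
lemma exists_triGen_dist_add_one {g h : Tri} (hne : g ≠ h) :
    ∃ s ∈ triGen, triGraph.dist (g * s) h + 1 = triGraph.dist g h := by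
  obtain ⟨p, hp⟩ := triGraph_connected.exists_walk_length_eq_dist g h
  cases p with
  | nil => exact absurd rfl hne
  | @cons _ v _ hadj q =>
    refine ⟨g⁻¹ * v, (triGraph_adj.1 hadj).2, ?_⟩
    rw [mul_inv_cancel_left]
    have h1 : triGraph.dist v h ≤ q.length := SimpleGraph.dist_le q
    have h2 := triGraph_connected.dist_triangle (u := g) (v := v) (w := h)
    rw [SimpleGraph.dist_eq_one_iff_adj.2 hadj] at h2
    rw [SimpleGraph.Walk.length_cons] at hp
    omega

lemma wlen_one : wlen 1 = 0 := SimpleGraph.dist_self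

lemma wlen_mul_le {s : Tri} (hs : s ∈ triGen) (g : Tri) : wlen (g * s) ≤ wlen g + 1 := by
  rcases eq_or_adj_mul (g := g) hs with h | h
  · rw [← h]; omega
  · have h2 := triGraph_connected.dist_triangle (u := 1) (v := g) (w := g * s)
    rwa [SimpleGraph.dist_eq_one_iff_adj.2 h] at h2

lemma wlen_le_mul {s : Tri} (hs : s ∈ triGen) (g : Tri) : wlen g ≤ wlen (g * s) + 1 := by
  simpa using wlen_mul_le (inv_mem_triGen hs) (g * s)

lemma exists_wlen_mul_add_one {g : Tri} (hg : 0 < wlen g) :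
    ∃ s ∈ triGen, wlen (g * s) + 1 = wlen g := by
  have hne : g ≠ 1 := by
    rintro rfl
    simp [wlen_one] at hg
  simpa only [wlen, triGraph.dist_comm] using exists_triGen_dist_add_one hne

lemma isDeadEnd_of_forall_le {g : Tri} (h : ∀ s ∈ triGen, wlen (g * s) ≤ wlen g) :
    IsDeadEnd g := by
  intro z hz
  by_contra hne
  obtain ⟨s, hs, hd⟩ := exists_triGen_dist_add_one (Ne.symm hne)
  have h1 : wlen z ≤ wlen (g * s) + triGraph.dist (g * s) z := triGraph_connected.dist_triangle
  have h2 := h s hs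
  omega

lemma exists_wlen_mul_of_not_isDeadEnd {g : Tri} (h : ¬ IsDeadEnd g) :
    ∃ s ∈ triGen, wlen (g * s) = wlen g + 1 := by
  by_contra! hc
  refine h (isDeadEnd_of_forall_le fun s hs => ?_)
  have h1 := hc s hs
  have h2 := wlen_mul_le hs g
  omega

lemma exists_mem_triGen {P : Tri → Prop} :
    (∃ s ∈ triGen, P s) ↔ P triA ∨ P triB ∨ P triB⁻¹ := by
  simp [triGen]

/-- Around a corner `y, y * b` of a `14`-gon without dead ends, the word length is strictly
monotone along the `a`-edges, and its increment along the `b`-edge is the average of its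
increments along the two adjacent `a`-edges. -/
lemma wlen_corner {y : Tri} (hy : 0 < wlen y) (hx : 0 < wlen (y * triB))
    (dy : ¬ IsDeadEnd y) (dx : ¬ IsDeadEnd (y * triB)) :
    wlen (y * triA) ≠ wlen y ∧
    2 * ((wlen (y * triB) : ℤ) - wlen y) =
      (wlen y - wlen (y * triA)) + (wlen (y * triB * triA) - wlen (y * triB)) := by
  have hA : triA ∈ triGen := Or.inl rfl
  have hB : triB ∈ triGen := Or.inr (Or.inl rfl)
  have hB' : triB⁻¹ ∈ triGen := Or.inr (Or.inr rfl)
  have l1 := wlen_mul_le hA y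
  have l2 := wlen_le_mul hA y
  have l3 := wlen_mul_le hB y
  have l4 := wlen_le_mul hB y
  have l5 := wlen_mul_le hB' y
  have l6 := wlen_le_mul hB' y
  have l7 := wlen_mul_le hA (y * triB)
  have l8 := wlen_le_mul hA (y * triB)
  have l9 := wlen_mul_le hB (y * triB)
  have l10 := wlen_le_mul hB (y * triB)
  have e1 := exists_mem_triGen.1 (exists_wlen_mul_add_one hy)
  have e2 := exists_mem_triGen.1 (exists_wlen_mul_add_one hx)
  have e3 := exists_mem_triGen.1 (exists_wlen_mul_of_not_isDeadEnd dy)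
  have e4 := exists_mem_triGen.1 (exists_wlen_mul_of_not_isDeadEnd dx)
  rw [mul_assoc y triB triB, triB_mul_triB] at l9 l10 e2 e4
  rw [mul_inv_cancel_right] at e2 e4
  omega

/-- The generators together with the identity. -/
def triStep : Set Tri := insert 1 triGen

lemma one_mem_triStep : (1 : Tri) ∈ triStep := Or.inl rfl

lemma triStep_finite : triStep.Finite := by
  simp [triStep, triGen]

lemma triStep_pow_finite (k : ℕ) : (triStep ^ k).Finite := by
  induction k with
  | zero => simp
  | succ k ih => rw [pow_succ]; exact ih.mul triStep_finite

lemma wlen_le_of_mem_triStep_pow (k : ℕ) : ∀ {w : Tri}, w ∈ triStep ^ k → ∀ g : Tri,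
    wlen (g * w) ≤ wlen g + k ∧ wlen g ≤ wlen (g * w) + k := by
  induction k with
  | zero => intro w hw g; simp_all
  | succ k ih =>
    intro w hw g
    rw [pow_succ] at hw
    obtain ⟨v, hv, s, hs, rfl⟩ := Set.mem_mul.1 hw
    obtain ⟨h1, h2⟩ := ih hv g
    rw [← mul_assoc]
    rcases hs with rfl | hs
    · rw [mul_one]; omega
    · have h3 := wlen_mul_le hs (g * v)
      have h4 := wlen_le_mul hs (g * v)
      omega

lemma mul_triA_mul_triB_pow_mem (i : ℕ) : (triA * triB) ^ i ∈ triStep ^ (2 * i) := by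
  rw [pow_mul]
  refine Set.pow_mem_pow ?_
  rw [pow_two]
  exact Set.mul_mem_mul (Or.inr (Or.inl rfl)) (Or.inr (Or.inr (Or.inl rfl)))

/-- The `14`-gon through a vertex far from the base point contains a dead end, because
`7` is odd. -/
lemma exists_isDeadEnd_mul {g : Tri} (hg : 16 ≤ wlen g) :
    ∃ w ∈ triStep ^ 15, IsDeadEnd (g * w) := by
  by_contra! hc
  have hmono {k : ℕ} (hk : k ≤ 15) : triStep ^ k ⊆ triStep ^ 15 :=
    Set.pow_subset_pow_right one_mem_triStep hk
  have hpos {w : Tri} (hw : w ∈ triStep ^ 15) : 0 < wlen (g * w) := by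
    have := (wlen_le_of_mem_triStep_pow 15 hw g).2
    omega
  have hx (i : ℕ) (hi : i ≤ 7) : (triA * triB) ^ i ∈ triStep ^ 15 :=
    hmono (by omega) (mul_triA_mul_triB_pow_mem i)
  have hy (i : ℕ) (hi : i ≤ 7) : (triA * triB) ^ i * triA ∈ triStep ^ 15 := by
    refine hmono (k := 2 * i + 1) (by omega) ?_
    rw [pow_succ]
    exact Set.mul_mem_mul (mul_triA_mul_triB_pow_mem i) (Or.inr (Or.inl rfl))
  have key (i : ℕ) (hi : i < 7) :
      wlen (g * (triA * triB) ^ i) ≠ wlen (g * (triA * triB) ^ i * triA) ∧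
      2 * ((wlen (g * (triA * triB) ^ (i + 1)) : ℤ) - wlen (g * (triA * triB) ^ i * triA)) =
        (wlen (g * (triA * triB) ^ i * triA) - wlen (g * (triA * triB) ^ i)) +
        (wlen (g * (triA * triB) ^ (i + 1) * triA) - wlen (g * (triA * triB) ^ (i + 1))) := by
    have hs : g * ((triA * triB) ^ i * triA) * triB = g * (triA * triB) ^ (i + 1) := by
      rw [pow_succ]; group
    have ht : g * ((triA * triB) ^ i * triA) * triA = g * (triA * triB) ^ i := by
      rw [mul_assoc, mul_assoc _ triA triA, triA_mul_triA, mul_one]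
    have h := wlen_corner (hpos (hy i hi.le)) (by rw [hs]; exact hpos (hx (i + 1) hi))
      (hc _ (hy i hi.le)) (by rw [hs]; exact hc _ (hx (i + 1) hi))
    rwa [hs, ht, ← mul_assoc] at h
  have hlip (i : ℕ) : wlen (g * (triA * triB) ^ i * triA) ≤ wlen (g * (triA * triB) ^ i) + 1 ∧
      wlen (g * (triA * triB) ^ i) ≤ wlen (g * (triA * triB) ^ i * triA) + 1 :=
    ⟨wlen_mul_le (Or.inl rfl) _, wlen_le_mul (Or.inl rfl) _⟩
  have hodd (i : ℕ) (hi : i < 7) : ∃ k : ℤ,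
      (wlen (g * (triA * triB) ^ i * triA) : ℤ) - wlen (g * (triA * triB) ^ i) = 2 * k + 1 := by
    have h1 := (key i hi).1
    have h2 := hlip i
    rcases lt_or_gt_of_ne h1 with h | h
    · exact ⟨0, by omega⟩
    · exact ⟨-1, by omega⟩
  have hsum : ∑ i ∈ Finset.range 7,
      ((wlen (g * (triA * triB) ^ i * triA) : ℤ) - wlen (g * (triA * triB) ^ i)) = 0 := by
    have h0 := (key 0 (by omega)).2
    have h1 := (key 1 (by omega)).2
    have h2 := (key 2 (by omega)).2
    have h3 := (key 3 (by omega)).2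
    have h4 := (key 4 (by omega)).2
    have h5 := (key 5 (by omega)).2
    have h6 := (key 6 (by omega)).2
    norm_num only [triA_mul_triB_pow_seven, pow_zero] at h0 h1 h2 h3 h4 h5 h6
    simp only [Finset.sum_range_succ, Finset.sum_range_zero, pow_zero]
    linarith
  choose! k hk using hodd
  rw [Finset.sum_congr rfl fun i hi => hk i (Finset.mem_range.1 hi), Finset.sum_add_distrib,
    ← Finset.mul_sum] at hsum
  simp only [Finset.sum_const, Finset.card_range, nsmul_eq_mul, Nat.cast_ofNat] at hsum
  omega

/-- Every element can be shortened by any amount not exceeding its length. -/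
lemma exists_mem_triStep_pow_wlen (k : ℕ) {g : Tri} (hk : k ≤ wlen g) :
    ∃ w ∈ triStep ^ k, wlen (g * w) + k = wlen g := by
  induction k with
  | zero => exact ⟨1, by simp, by simp⟩
  | succ k ih =>
    obtain ⟨w, hw, h⟩ := ih (by omega)
    obtain ⟨s, hs, h'⟩ := exists_wlen_mul_add_one (g := g * w) (by omega)
    refine ⟨w * s, ?_, ?_⟩
    · rw [pow_succ]
      exact Set.mul_mem_mul hw (Or.inr hs)
    · rw [← mul_assoc]; omega

lemma finite_setOf_wlen_le (n : ℕ) : {g : Tri | wlen g ≤ n}.Finite := by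
  refine (triStep_pow_finite n).inv.subset fun g hg => ?_
  obtain ⟨w, hw, h⟩ := exists_mem_triStep_pow_wlen (wlen g) (g := g) le_rfl
  have h1 : g * w = 1 := by
    by_contra hne
    have hpos : 0 < wlen (g * w) := triGraph_connected.pos_dist_of_ne (Ne.symm hne)
    omega
  rw [Set.mem_inv, inv_eq_of_mul_eq_one_right h1]
  exact Set.pow_subset_pow_right one_mem_triStep hg hw

lemma exists_isDeadEnd : ∃ g : Tri, IsDeadEnd g := by
  by_cases h : ∃ g : Tri, 16 ≤ wlen g
  · obtain ⟨g, hg⟩ := h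
    obtain ⟨w, -, hw⟩ := exists_isDeadEnd_mul hg
    exact ⟨_, hw⟩
  · push Not at h
    have hfin : (Set.univ : Set Tri).Finite :=
      (finite_setOf_wlen_le 16).subset fun g _ => (h g).le
    obtain ⟨g, -, hg⟩ := hfin.exists_maximalFor wlen _ ⟨1, trivial⟩
    exact ⟨g, isDeadEnd_of_forall_le fun s _ => (le_total _ _).elim id (hg trivial)⟩

/-- In every large ball, each element is within a bounded distance of a dead end in the ball. -/
lemma exists_finite_forall_mul_isDeadEnd : ∃ F : Set Tri, F.Finite ∧ ∃ N : ℕ, ∀ n ≥ N,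
    {g : Tri | wlen g ≤ n} ⊆ {g : Tri | wlen g ≤ n ∧ IsDeadEnd g} * F := by
  obtain ⟨d, hd⟩ := exists_isDeadEnd
  refine ⟨(triStep ^ 15 * triStep ^ 15)⁻¹ ∪ {d⁻¹} * {g | wlen g ≤ 31},
    ((triStep_pow_finite 15).mul (triStep_pow_finite 15)).inv.union
      ((Set.finite_singleton _).mul (finite_setOf_wlen_le 31)), wlen d, fun n hn g hg => ?_⟩
  rw [Set.mem_ofPred_eq] at hg
  by_cases hl : wlen g ≤ 31
  · exact ⟨d, ⟨hn, hd⟩, d⁻¹ * g, Or.inr (Set.mul_mem_mul rfl hl), by simp⟩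
  · obtain ⟨v, hv, h⟩ := exists_mem_triStep_pow_wlen 15 (g := g) (by omega)
    obtain ⟨w, hw, hdead⟩ := exists_isDeadEnd_mul (g := g * v) (by omega)
    have h2 := (wlen_le_of_mem_triStep_pow 15 hw (g * v)).1
    refine ⟨g * v * w, ⟨by omega, hdead⟩, (v * w)⁻¹, Or.inl ?_, by simp [mul_assoc]⟩
    exact Set.inv_mem_inv.2 (Set.mul_mem_mul hv hw)

/-- the dead-end elements of the (2,3,7) triangle group (with respect
to `S = {a, b, b⁻¹}`) have positive lower density. -/
theorem triangle_group_dead_end_density :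
    0 < Filter.liminf (fun n : ℕ =>
      (Nat.card {g : Tri | wlen g ≤ n ∧ IsDeadEnd g} : ℝ) /
      (Nat.card {g : Tri | wlen g ≤ n} : ℝ)) Filter.atTop := by
  obtain ⟨F, hF, N, hN⟩ := exists_finite_forall_mul_isDeadEnd
  have hball (n : ℕ) : (0 : ℝ) < Nat.card {g : Tri | wlen g ≤ n} := by
    have : Nonempty {g : Tri | wlen g ≤ n} := ⟨⟨1, by simp [wlen_one]⟩⟩
    have := (finite_setOf_wlen_le n).to_subtype
    exact_mod_cast Nat.card_pos
  have hle (n : ℕ) (hn : N ≤ n) : (Nat.card {g : Tri | wlen g ≤ n} : ℝ) ≤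
      Nat.card {g : Tri | wlen g ≤ n ∧ IsDeadEnd g} * Nat.card F := by
    have hfin : {g : Tri | wlen g ≤ n ∧ IsDeadEnd g}.Finite :=
      (finite_setOf_wlen_le n).subset fun _ h => h.1
    exact_mod_cast (Nat.card_mono (hfin.mul hF) (hN n hn)).trans (Set.natCard_mul_le ..)
  have hFpos : (0 : ℝ) < Nat.card F := by
    refine (Nat.cast_nonneg _).lt_of_ne fun h => ?_
    have h1 := hle N le_rfl
    rw [← h, mul_zero] at h1
    exact (hball N).not_ge h1
  refine (inv_pos.2 hFpos).trans_le (Filter.le_liminf_of_le ?_ ?_)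
  · refine Filter.IsBoundedUnder.isCoboundedUnder_ge
      (Filter.isBoundedUnder_of ⟨1, fun n => div_le_one_of_le₀ ?_ (hball n).le⟩)
    have hsub : {g : Tri | wlen g ≤ n ∧ IsDeadEnd g} ⊆ {g : Tri | wlen g ≤ n} := fun _ h => h.1
    exact_mod_cast Nat.card_mono (finite_setOf_wlen_le n) hsub
  · filter_upwards [Filter.eventually_ge_atTop N] with n hn
    rw [le_div_iff₀ (hball n), inv_mul_le_iff₀ hFpos, mul_comm]
    exact hle n hn

end CF
end
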